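/- arXiv:2003.14232 — 6 statements merged into one kernel-verified Lean document; each statement's English description precedes it below -/
import Mathlib

section
/- Let K be a field of characteristic p > 0 and let f ∈ S = K[x₁,…,xₙ] be a polynomial whose leading term lt(f) with respect to a fixed term order ≺ is a squarefree monomial. If I ∈ C_f, then the initial ideal lt(I) is a squarefree monomial ideal; in particular, I is a radical ideal. -/
open MvPolynomial

/-- The leading exponent (degree) of a multivariate polynomial with respect to a
monomial order: the maximum of its support. -/
noncomputable def MonomialOrder.degreeOf {σ : Type*} {K : Type*} [CommSemiring K]
    (m : MonomialOrder σ) (f : MvPolynomial σ K) : σ →₀ ℕ :=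
  m.toSyn.symm (f.support.sup m.toSyn)

/-- The leading term `lt(f)` of a polynomial with respect to a monomial order. -/
noncomputable def MonomialOrder.leadTerm {σ : Type*} {K : Type*} [CommSemiring K]
    (m : MonomialOrder σ) (f : MvPolynomial σ K) : MvPolynomial σ K :=
  monomial (m.degreeOf f) (f.coeff (m.degreeOf f))

/-- The initial ideal `lt(I)` of an ideal, generated by leading terms of its
nonzero elements. -/
noncomputable def MonomialOrder.initialIdeal {σ : Type*} {K : Type*} [CommSemiring K]
    (m : MonomialOrder σ) (I : Ideal (MvPolynomial σ K)) : Ideal (MvPolynomial σ K) :=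
  Ideal.span { g | ∃ f ∈ I, f ≠ 0 ∧ g = m.leadTerm f }

/-- The leading term of `f` is a squarefree monomial. -/
def MonomialOrder.HasSqfreeLeadTerm {σ : Type*} {K : Type*} [CommSemiring K]
    (m : MonomialOrder σ) (f : MvPolynomial σ K) : Prop :=
  f ≠ 0 ∧ ∀ i, m.degreeOf f i ≤ 1

/-- The family `C_f` of Knutson ideals associated to `f` : the smallest family of ideals
containing `(f)`, closed under colon by arbitrary ideals, sums and intersections. -/
inductive KnutsonFamily {σ : Type*} {K : Type*} [Field K] (f : MvPolynomial σ K) :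
    Ideal (MvPolynomial σ K) → Prop
  | base : KnutsonFamily f (Ideal.span {f})
  | colon (I J : Ideal (MvPolynomial σ K)) : KnutsonFamily f I → KnutsonFamily f (I.colon J)
  | add (I J : Ideal (MvPolynomial σ K)) :
      KnutsonFamily f I → KnutsonFamily f J → KnutsonFamily f (I + J)
  | inter (I J : Ideal (MvPolynomial σ K)) :
      KnutsonFamily f I → KnutsonFamily f J → KnutsonFamily f (I ⊓ J)

/-- A squarefree monomial ideal : an ideal generated by squarefree monomials. -/
def IsSqfreeMonomialIdeal {σ : Type*} {K : Type*} [CommSemiring K]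
    (J : Ideal (MvPolynomial σ K)) : Prop :=
  ∃ G : Set (MvPolynomial σ K),
    (∀ g ∈ G, ∃ s : Finset σ, g = ∏ i ∈ s, X i) ∧ J = Ideal.span G


/-- A `p`-inverse-linear splitting of a field homomorphism. -/
lemma exists_semilinear_splitting {K L : Type*} [Field K] [Field L] (φ : K →+* L) :
    ∃ l : L →+ K, (∀ a b, l (φ a * b) = a * l b) ∧ l 1 = 1 := by
  let _ := φ.toAlgebra
  obtain ⟨g, hg⟩ := LinearMap.exists_leftInverse_of_injective (Algebra.linearMap K L)
    (LinearMap.ker_eq_bot.2 φ.injective)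
  refine ⟨g.toAddMonoidHom, fun a b => ?_, ?_⟩
  · have := g.map_smul a b
    rw [Algebra.smul_def] at this
    exact this
  · have := LinearMap.congr_fun hg 1
    simpa using this

/-- The all-`c` exponent vector. -/
noncomputable def constExp (n c : ℕ) : Fin n →₀ ℕ := Finsupp.equivFunOnFinite.symm (fun _ => c)

@[simp] lemma constExp_apply (n c : ℕ) (i : Fin n) : constExp n c i = c := rfl

/-- The trace-like map. -/
lemma exists_trace {n : ℕ} {K : Type*} [Field K] (p : ℕ) [CharP K p] (hp : p.Prime) :
    ∃ T : MvPolynomial (Fin n) K →+ MvPolynomial (Fin n) K, ∃ l : K →+ K,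
      (∀ a b, T (a ^ p * b) = a * T b) ∧ l 1 = 1 ∧
      ∀ g d, coeff d (T g) = l (coeff (p • d + constExp n (p - 1)) g) := by
  classical
  have : Fact p.Prime := ⟨hp⟩
  obtain ⟨l, hl, hl1⟩ := exists_semilinear_splitting (frobenius K p)
  have hinj : Function.Injective (fun d : Fin n →₀ ℕ => p • d + constExp n (p - 1)) := by
    intro a b hab
    ext i
    have := DFunLike.congr_fun hab i
    simpa [hp.ne_zero] using this
  have hex : ∀ g : MvPolynomial (Fin n) K, ∃ t : MvPolynomial (Fin n) K,
      ∀ d, coeff d t = l (coeff (p • d + constExp n (p - 1)) g) := by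
    intro g
    refine ⟨∑ d ∈ g.support.preimage _ hinj.injOn,
      monomial d (l (coeff (p • d + constExp n (p - 1)) g)), fun d => ?_⟩
    rw [coeff_sum]
    simp only [coeff_monomial]
    rw [Finset.sum_ite_eq']
    split_ifs with h
    · rfl
    · rw [Finset.mem_preimage, mem_support_iff, not_not] at h
      rw [h, map_zero]
  choose T hT using hex
  let T' : MvPolynomial (Fin n) K →+ MvPolynomial (Fin n) K :=
    AddMonoidHom.mk' T (fun a b => by ext d; simp [hT])
  refine ⟨T', l, fun a b => ?_, hl1, hT⟩
  induction a using MvPolynomial.induction_on' with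
  | monomial u c =>
    ext d
    change coeff d (T _) = coeff d (_ * T b)
    rw [hT, monomial_pow, coeff_monomial_mul', coeff_monomial_mul', hT]
    have hiff : p • u ≤ p • d + constExp n (p - 1) ↔ u ≤ d := by
      simp only [Finsupp.le_def]
      refine forall_congr' fun i => ?_
      have h0 := hp.pos
      simp only [Finsupp.add_apply, Finsupp.smul_apply, smul_eq_mul, constExp_apply]
      constructor
      · intro h
        by_contra hc
        have : p * (d i + 1) ≤ p * u i := Nat.mul_le_mul_left _ (by omega)
        rw [mul_add] at this
        omega
      · intro h
        have := Nat.mul_le_mul_left p h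
        omega
    by_cases h : u ≤ d
    · rw [if_pos h, if_pos (hiff.2 h)]
      have : p • d + constExp n (p - 1) - p • u = p • (d - u) + constExp n (p - 1) := by
        ext i
        have := Nat.mul_le_mul_left p (h i)
        simp only [Finsupp.add_apply, Finsupp.tsub_apply, Finsupp.smul_apply, smul_eq_mul,
          constExp_apply, Nat.mul_sub]
        omega
      rw [this, ← hl]
      rfl
    · rw [if_neg h, if_neg (fun h' => h (hiff.1 h')), map_zero]
  | add a a' ha ha' =>
    rw [add_pow_char, add_mul, map_add, ha, ha', add_mul]

lemma knutson_stable {n : ℕ} {K : Type*} [Field K] {p : ℕ} (hp : 0 < p)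
    (T : MvPolynomial (Fin n) K →+ MvPolynomial (Fin n) K)
    (hT : ∀ a b, T (a ^ p * b) = a * T b) (f h : MvPolynomial (Fin n) K)
    (I : Ideal (MvPolynomial (Fin n) K)) (hI : KnutsonFamily f I) :
    ∀ g ∈ I, T ((f * h) ^ (p - 1) * g) ∈ I := by
  induction hI with
  | base =>
    intro g hg
    obtain ⟨c, rfl⟩ := Ideal.mem_span_singleton'.1 hg
    have : (f * h) ^ (p - 1) * (c * f) = f ^ p * (h ^ (p - 1) * c) := by
      obtain ⟨q, rfl⟩ : ∃ q, p = q + 1 := ⟨p - 1, by omega⟩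
      simp only [Nat.add_sub_cancel]
      ring
    rw [this, hT]
    exact Ideal.mul_mem_right _ _ (Ideal.mem_span_singleton_self f)
  | colon I J _ ih =>
    intro g hg
    rw [Submodule.mem_colon] at hg ⊢
    intro j hj
    have h1 := ih (g * j ^ p) (by
      obtain ⟨q, rfl⟩ : ∃ q, p = q + 1 := ⟨p - 1, by omega⟩
      have := Ideal.mul_mem_left I (j ^ q) (hg j hj)
      rw [smul_eq_mul] at this
      convert this using 1
      ring)
    rw [← mul_assoc, mul_comm _ (j ^ p), hT, mul_comm] at h1
    exact h1
  | add I J _ _ ihI ihJ =>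
    intro g hg
    obtain ⟨a, ha, b, hb, rfl⟩ := Submodule.mem_sup.1 hg
    rw [mul_add, map_add]
    exact Submodule.add_mem_sup (ihI a ha) (ihJ b hb)
  | inter I J _ _ ihI ihJ =>
    intro g hg
    exact ⟨ihI g hg.1, ihJ g hg.2⟩

lemma smul_toSyn_lt {n : ℕ} (m : MonomialOrder (Fin n)) {p : ℕ} (hp : 0 < p)
    (a b c : Fin n →₀ ℕ) (h : m.toSyn a < m.toSyn b) :
    m.toSyn (p • a + c) < m.toSyn (p • b + c) := by
  simp only [map_add, map_nsmul]
  have : p • m.toSyn a < p • m.toSyn b := nsmul_lt_nsmul_right hp.ne' h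
  simpa using this

/-- The key leading term computation. -/
lemma degree_trace {n : ℕ} {K : Type*} [Field K] {p : ℕ} (hp : 0 < p) (m : MonomialOrder (Fin n))
    (T : MvPolynomial (Fin n) K →+ MvPolynomial (Fin n) K) (l : K →+ K) (hl : l 1 = 1)
    (hT : ∀ g d, coeff d (T g) = l (coeff (p • d + constExp n (p - 1)) g))
    (F : MvPolynomial (Fin n) K) (hF : m.degree F = constExp n 1) (hF1 : m.leadingCoeff F = 1)
    (g : MvPolynomial (Fin n) K) (d : Fin n →₀ ℕ) (hg : m.degree g = p • d)
    (hg1 : m.leadingCoeff g = 1) :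
    T (F ^ (p - 1) * g) ≠ 0 ∧ m.degree (T (F ^ (p - 1) * g)) = d := by
  have hF0 : F ≠ 0 := by rintro rfl; simp at hF1
  have hg0 : g ≠ 0 := by rintro rfl; simp at hg1
  have hdeg : m.degree (F ^ (p - 1) * g) = p • d + constExp n (p - 1) := by
    rw [m.degree_mul (pow_ne_zero _ hF0) hg0, m.degree_pow, hF, hg, add_comm]
    congr 1
    ext i
    simp
  have hlc : m.leadingCoeff (F ^ (p - 1) * g) = 1 := by
    rw [m.leadingCoeff_mul, m.leadingCoeff_pow, hF1, hg1]; simp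
  have hc : coeff d (T (F ^ (p - 1) * g)) = 1 := by
    rw [hT, ← hdeg]
    change l (m.leadingCoeff _) = 1
    rw [hlc, hl]
  have hne : T (F ^ (p - 1) * g) ≠ 0 := by
    intro h; rw [h] at hc; simp at hc
  refine ⟨hne, ?_⟩
  apply m.toSyn.injective
  apply le_antisymm
  · by_contra hlt
    rw [not_le] at hlt
    apply m.coeff_degree_ne_zero_iff.2 hne
    rw [hT, m.coeff_eq_zero_of_lt, map_zero]
    rw [hdeg]
    exact smul_toSyn_lt m hp _ _ _ hlt
  · apply m.le_degree
    rw [mem_support_iff, hc]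
    exact one_ne_zero

lemma exists_sqfree_le {n : ℕ} (p : ℕ) (hp : 2 ≤ p) (M : (Fin n →₀ ℕ) → Prop)
    (hM : ∀ e d : Fin n →₀ ℕ, M e → e ≤ p • d → M d) :
    ∀ k, ∀ e : Fin n →₀ ℕ, (∑ i, e i) ≤ k → M e → ∃ d, M d ∧ d ≤ e ∧ ∀ i, d i ≤ 1 := by
  intro k
  induction k with
  | zero =>
    intro e he hMe
    refine ⟨e, hMe, le_rfl, fun i => ?_⟩
    have := Finset.single_le_sum (f := fun i => e i) (fun _ _ => Nat.zero_le _)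
      (Finset.mem_univ i)
    omega
  | succ k ih =>
    intro e he hMe
    by_cases h : ∀ i, e i ≤ 1
    · exact ⟨e, hMe, le_rfl, h⟩
    push Not at h
    obtain ⟨j, hj⟩ := h
    let d : Fin n →₀ ℕ := e - Finsupp.single j 1
    have hdj : d j = e j - 1 := by simp [d]
    have hdi : ∀ i, i ≠ j → d i = e i := by
      intro i hi
      simp [d, Ne.symm hi]
    have hd : e ≤ p • d := by
      intro i
      have h2 : 2 * d i ≤ p * d i := Nat.mul_le_mul_right _ hp
      simp only [Finsupp.smul_apply, smul_eq_mul]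
      by_cases hi : i = j
      · subst hi; omega
      · have := hdi i hi; omega
    have hde : d ≤ e := tsub_le_self
    have hlt : ∑ i, d i < ∑ i, e i :=
      Finset.sum_lt_sum (fun i _ => hde i) ⟨j, Finset.mem_univ j, by omega⟩
    obtain ⟨d', h1, h2, h3⟩ := ih d (by omega) (hM e d hMe hd)
    exact ⟨d', h1, h2.trans hde, h3⟩

lemma prod_X_eq_monomial {n : ℕ} {K : Type*} [Field K] (d : Fin n →₀ ℕ) (hd : ∀ i, d i ≤ 1) :
    (∏ i ∈ d.support, X i : MvPolynomial (Fin n) K) = monomial d 1 := by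
  rw [monomial_eq, C_1, one_mul, Finsupp.prod]
  refine Finset.prod_congr rfl fun i hi => ?_
  have := hd i
  have h2 := Finsupp.mem_support_iff.1 hi
  rw [show d i = 1 by omega, pow_one]

/-- **Proposition (char p).** Over a field of characteristic `p > 0`, if `f` has squarefree
leading term and `I ∈ C_f`, then `lt(I)` is a squarefree monomial ideal;
in particular `I` is radical. -/
theorem knutson_initialIdeal_sqfree_charP {n : ℕ} {K : Type*} [Field K]
    (p : ℕ) [CharP K p] (hp : 0 < p)
    (m : MonomialOrder (Fin n)) (f : MvPolynomial (Fin n) K)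
    (hf : m.HasSqfreeLeadTerm f)
    (I : Ideal (MvPolynomial (Fin n) K)) (hI : KnutsonFamily f I) :
    IsSqfreeMonomialIdeal (m.initialIdeal I) ∧ I.IsRadical := by
  have hp' : p.Prime := (CharP.char_is_prime_or_zero K p).resolve_right hp.ne'
  obtain ⟨T, l, hT, hl, hTc⟩ := exists_trace (n := n) (K := K) p hp'
  obtain ⟨hf0, hfs⟩ := hf
  have hfs' : ∀ i, m.degree f i ≤ 1 := hfs
  have hlf : m.leadingCoeff f ≠ 0 := m.leadingCoeff_ne_zero_iff.2 hf0
  let h : MvPolynomial (Fin n) K := monomial (constExp n 1 - m.degree f) (m.leadingCoeff f)⁻¹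
  have hh0 : h ≠ 0 := by simpa [h] using hf0
  have hFd : m.degree (f * h) = constExp n 1 := by
    classical
    rw [m.degree_mul hf0 hh0]
    have : m.degree h = constExp n 1 - m.degree f := by
      simp only [h]
      rw [m.degree_monomial, if_neg (inv_ne_zero hlf)]
    rw [this]
    exact add_tsub_cancel_of_le fun i => hfs' i
  have hF1 : m.leadingCoeff (f * h) = 1 := by
    rw [m.leadingCoeff_mul, m.leadingCoeff_monomial, mul_inv_cancel₀ hlf]
  have hst := knutson_stable hp T hT f h I hI
  -- the set of leading exponents
  let M : (Fin n →₀ ℕ) → Prop := fun e => ∃ g ∈ I, m.leadingCoeff g = 1 ∧ m.degree g = e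
  have hMof : ∀ g ∈ I, g ≠ 0 → M (m.degree g) := by
    intro g hg hg0
    have hlg : m.leadingCoeff g ≠ 0 := m.leadingCoeff_ne_zero_iff.2 hg0
    refine ⟨C (m.leadingCoeff g)⁻¹ * g, Ideal.mul_mem_left _ _ hg, ?_, ?_⟩
    · rw [m.leadingCoeff_mul, m.leadingCoeff_C, inv_mul_cancel₀ hlg]
    · rw [m.degree_mul (by simpa using hg0) hg0, m.degree_C, zero_add]
  have hM : ∀ e d : Fin n →₀ ℕ, M e → e ≤ p • d → M d := by
    classical
    rintro e d ⟨g, hg, hg1, rfl⟩ hle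
    have hg0 : g ≠ 0 := by rintro rfl; simp at hg1
    have hdt := degree_trace hp m T l hl hTc (f * h) hFd hF1
      (monomial (p • d - m.degree g) 1 * g) d
      (by rw [m.degree_mul (by simp) hg0, m.degree_monomial, if_neg one_ne_zero,
            tsub_add_cancel_of_le hle])
      (by rw [m.leadingCoeff_mul, m.leadingCoeff_monomial, hg1, one_mul])
    rw [← hdt.2]
    exact hMof _ (hst _ (Ideal.mul_mem_left _ _ hg)) hdt.1
  constructor
  · refine ⟨{g | ∃ d, M d ∧ (∀ i, d i ≤ 1) ∧ g = monomial d 1}, ?_, ?_⟩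
    · rintro g ⟨d, -, hd, rfl⟩
      exact ⟨d.support, (prod_X_eq_monomial d hd).symm⟩
    · apply le_antisymm
      · refine Ideal.span_le.2 ?_
        rintro _ ⟨g, hg, hg0, rfl⟩
        obtain ⟨d, hMd, hd, hd1⟩ := exists_sqfree_le p hp'.two_le M hM _ _ le_rfl (hMof g hg hg0)
        have : m.leadTerm g = monomial (m.degree g - d) (m.leadingCoeff g) * monomial d 1 := by
          rw [monomial_mul, tsub_add_cancel_of_le hd, mul_one]
          rfl
        rw [this]
        exact Ideal.mul_mem_left _ _ (Ideal.subset_span ⟨d, hMd, hd1, rfl⟩)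
      · refine Ideal.span_le.2 ?_
        rintro _ ⟨d, ⟨g, hg, hg1, rfl⟩, hd, rfl⟩
        refine Ideal.subset_span ⟨g, hg, by rintro rfl; simp at hg1, ?_⟩
        rw [← hg1]
        rfl
  · -- the splitting sends `1` to `1`
    have h1 : T ((f * h) ^ (p - 1)) = 1 := by
      have hdt := degree_trace hp m T l hl hTc (f * h) hFd hF1 1 0 (by simp) (by simp)
      rw [mul_one] at hdt
      rw [m.eq_C_of_degree_eq_zero hdt.2]
      have : m.leadingCoeff (T ((f * h) ^ (p - 1))) = 1 := by
        rw [MonomialOrder.leadingCoeff, hdt.2, hTc]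
        have h2 : p • (0 : Fin n →₀ ℕ) + constExp n (p - 1) = (p - 1) • m.degree (f * h) := by
          rw [hFd]; ext i; simp
        rw [h2, m.coeff_pow_nsmul_degree, hF1, one_pow, hl]
      rw [this, C_1]
    have hroot : ∀ g, g ^ p ∈ I → g ∈ I := by
      intro g hg
      have := hst _ hg
      rwa [mul_comm, hT, h1, mul_one] at this
    have hiter : ∀ k, ∀ g, g ^ p ^ k ∈ I → g ∈ I := by
      intro k
      induction k with
      | zero => intro g hg; simpa using hg
      | succ k ih =>
        intro g hg
        rw [pow_succ, pow_mul] at hg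
        exact ih g (hroot _ hg)
    rintro g ⟨k, hk⟩
    exact hiter k g (Ideal.pow_mem_of_pow_mem I hk (Nat.lt_pow_self hp'.one_lt).le)
end

section
/- Let K be a field of characteristic 0 and let f ∈ S = K[x₁,…,xₙ] be a polynomial whose leading term lt(f) with respect to a fixed term order ≺ is a squarefree monomial. If I ∈ C_f, then the initial ideal lt(I) is a squarefree monomial ideal; in particular, I is a radical ideal. -/
open MvPolynomial

namespace KnutsonAux

section Lead

variable {σ : Type*} (m : MonomialOrder σ) {R : Type*} [CommRing R]

theorem lead_induction (P : MvPolynomial σ R → Prop) (h0 : P 0)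
    (step : ∀ g, g ≠ 0 →
      (∀ g' : MvPolynomial σ R, (∀ a ∈ g'.support, m.toSyn a < m.toSyn (m.degree g)) → P g') → P g) :
    ∀ g, P g := by
  have key : ∀ d : m.syn, ∀ g : MvPolynomial σ R, (∀ a ∈ g.support, m.toSyn a < d) → P g := by
    intro d
    induction d using WellFoundedLT.induction with
    | ind d ih =>
      intro g hg
      by_cases hg0 : g = 0
      · rw [hg0]; exact h0
      · exact step g hg0 (fun g' hg' => ih _ (hg _ (m.degree_mem_support hg0)) g' hg')
  intro g
  by_cases hg0 : g = 0
  · rw [hg0]; exact h0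
  · exact step g hg0 (fun g' hg' => key _ g' hg')

theorem sub_support_lt {g h : MvPolynomial σ R} (hd : m.toSyn (m.degree h) ≤ m.toSyn (m.degree g))
    (hc : h.coeff (m.degree g) = g.coeff (m.degree g)) :
    ∀ a ∈ (g - h).support, m.toSyn a < m.toSyn (m.degree g) := by
  intro a ha
  by_contra hlt
  rw [not_lt] at hlt
  rw [mem_support_iff, coeff_sub] at ha
  rcases hlt.eq_or_lt with h1 | h1
  · have : m.degree g = a := m.toSyn.injective h1
    subst this
    exact ha (by rw [hc, sub_self])
  · exact ha (by rw [m.coeff_eq_zero_of_lt h1, m.coeff_eq_zero_of_lt (hd.trans_lt h1), sub_self])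

/-- the set of leading exponents of an ideal -/
def LT (I : Ideal (MvPolynomial σ R)) : Set (σ →₀ ℕ) :=
  {a | ∃ g ∈ I, g ≠ 0 ∧ m.degree g = a}

theorem LT_upper [IsDomain R] {I : Ideal (MvPolynomial σ R)} {a b : σ →₀ ℕ} (ha : a ∈ LT m I)
    (hab : a ≤ b) : b ∈ LT m I := by
  obtain ⟨g, hg, hg0, rfl⟩ := ha
  have h1 : (monomial (b - m.degree g) (1 : R)) ≠ 0 := by simp
  refine ⟨monomial (b - m.degree g) 1 * g, I.mul_mem_left _ hg, mul_ne_zero h1 hg0, ?_⟩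
  classical
  rw [m.degree_mul h1 hg0, m.degree_monomial, if_neg one_ne_zero, tsub_add_cancel_of_le hab]

/-- a monomial multiple of a monic polynomial -/
theorem monic_shift [Nontrivial R] {h : MvPolynomial σ R} (hh : m.Monic h) {a : σ →₀ ℕ}
    (ha : m.degree h ≤ a) :
    m.degree (monomial (a - m.degree h) (1 : R) * h) = a ∧
    coeff a (monomial (a - m.degree h) (1 : R) * h) = 1 := by
  classical
  have e : m.degree (monomial (a - m.degree h) (1 : R) * h) = a := by
    rw [m.degree_mul_of_mul_leadingCoeff_ne_zero, m.degree_monomial, if_neg one_ne_zero,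
      tsub_add_cancel_of_le ha]
    rw [m.leadingCoeff_monomial, hh.leadingCoeff_eq_one]; simp
  refine ⟨e, ?_⟩
  have := coeff_monomial_mul (m.degree h) (a - m.degree h) (1 : R) h
  rw [tsub_add_cancel_of_le ha] at this
  rw [this, hh.coeff_degree, mul_one]

end Lead

section GB

variable {σ : Type*} (m : MonomialOrder σ) {K : Type*} [Field K]

/-- finite monic Groebner basis -/
def IsGB (L : Ideal (MvPolynomial σ K)) (G : Finset (MvPolynomial σ K)) : Prop :=
  (∀ g ∈ G, g ∈ L ∧ m.Monic g) ∧ ∀ h ∈ L, h ≠ 0 → ∃ g ∈ G, m.degree g ≤ m.degree h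

theorem exists_monic {L : Ideal (MvPolynomial σ K)} {a : σ →₀ ℕ} (ha : a ∈ LT m L) :
    ∃ g ∈ L, m.Monic g ∧ m.degree g = a := by
  obtain ⟨g, hg, hg0, rfl⟩ := ha
  have hl : m.leadingCoeff g ≠ 0 := by rwa [m.leadingCoeff_ne_zero_iff]
  have hC : (C (m.leadingCoeff g)⁻¹ : MvPolynomial σ K) ≠ 0 := by simpa using hg0
  refine ⟨C (m.leadingCoeff g)⁻¹ * g, L.mul_mem_left _ hg, ?_, ?_⟩
  · unfold MonomialOrder.Monic
    rw [m.leadingCoeff_mul, m.leadingCoeff_C, inv_mul_cancel₀ hl]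
  · rw [m.degree_mul hC hg0, m.degree_C, zero_add]

theorem exists_gb [Finite σ] (L : Ideal (MvPolynomial σ K)) : ∃ G, IsGB m L G := by
  classical
  have hpwo : (LT m L).IsPWO := Set.isPWO_of_wellQuasiOrderedLE _
  have hfin : {a | Minimal (· ∈ LT m L) a}.Finite := by
    have hac : IsAntichain (· ≤ ·) {a | Minimal (· ∈ LT m L) a} := setOfPred_minimal_antichain _
    exact hac.finite_of_partiallyWellOrderedOn (Set.isPWO_of_wellQuasiOrderedLE _)
  choose! u hu using fun a (ha : a ∈ LT m L) => exists_monic m ha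
  refine ⟨hfin.toFinset.image u, ?_, ?_⟩
  · intro g hg
    simp only [Finset.mem_image, Set.Finite.mem_toFinset, Set.mem_ofPred_eq] at hg
    obtain ⟨a, ha, rfl⟩ := hg
    exact ⟨(hu a ha.prop).1, (hu a ha.prop).2.1⟩
  · intro h hh hh0
    have hm : m.degree h ∈ LT m L := ⟨h, hh, hh0, rfl⟩
    obtain ⟨b, hb, hbm⟩ := exists_minimal_le_of_wellFoundedLT (· ∈ LT m L) _ hm
    refine ⟨u b, ?_, ?_⟩
    · simp only [Finset.mem_image, Set.Finite.mem_toFinset, Set.mem_ofPred_eq]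
      exact ⟨b, hbm, rfl⟩
    · rw [(hu b hbm.prop).2.2]; exact hb

variable {A : Type*} [CommRing A] (ι : A →+* K) (hι : Function.Injective ι)
include hι

theorem degree_map_inj (g : MvPolynomial σ A) : m.degree (map ι g) = m.degree g := by
  unfold MonomialOrder.degree
  rw [support_map_of_injective _ hι]

theorem monic_of_map {g : MvPolynomial σ A} (h : m.Monic (map ι g)) : m.Monic g := by
  unfold MonomialOrder.Monic MonomialOrder.leadingCoeff at *
  rw [degree_map_inj m ι hι, coeff_map] at h
  exact hι (by rw [h, map_one])

theorem gb_head {L : Ideal (MvPolynomial σ K)} {G : Finset (MvPolynomial σ K)}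
    (hG : IsGB m L G) {M : Ideal (MvPolynomial σ A)}
    (hM : ∀ g ∈ G, ∃ g' ∈ M, map ι g' = g) {g : MvPolynomial σ A} (hg : map ι g ∈ L)
    (hg0 : g ≠ 0) : ∃ h ∈ M, map ι h ∈ L ∧ m.degree h = m.degree g ∧ coeff (m.degree g) h = 1 := by
  have : Nontrivial A := ι.domain_nontrivial
  have h0 : map ι g ≠ 0 := by
    rw [Ne, map_eq_zero_iff _ (map_injective ι hι)]; exact hg0
  obtain ⟨u, hu, hud⟩ := hG.2 _ hg h0
  obtain ⟨v, hv, rfl⟩ := hM u hu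
  rw [degree_map_inj m ι hι, degree_map_inj m ι hι] at hud
  have hvm := monic_of_map m ι hι (hG.1 _ hu).2
  obtain ⟨h1, h2⟩ := monic_shift m hvm hud
  refine ⟨_, M.mul_mem_left _ hv, ?_, h1, h2⟩
  rw [map_mul]
  exact L.mul_mem_left _ (hG.1 _ hu).1

theorem gb_mem {L : Ideal (MvPolynomial σ K)} {G : Finset (MvPolynomial σ K)}
    (hG : IsGB m L G) {M : Ideal (MvPolynomial σ A)}
    (hM : ∀ g ∈ G, ∃ g' ∈ M, map ι g' = g) (𝔞 : Ideal A) :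
    ∀ g : MvPolynomial σ A, map ι g ∈ L → (∀ a, coeff a g ∈ 𝔞) → g ∈ 𝔞.map C * M := by
  apply lead_induction m
  · intro _ _; exact zero_mem _
  · intro g hg0 ih hg hc
    obtain ⟨h, hhM, hhL, hd, h1⟩ := gb_head m ι hι hG hM hg hg0
    set c := coeff (m.degree g) g with hcdef
    have hs := ih (g - C c * h) (sub_support_lt m ?_ ?_) ?_ ?_
    · have : g = (g - C c * h) + C c * h := by ring
      rw [this]
      exact add_mem hs (Ideal.mul_mem_mul (Ideal.mem_map_of_mem _ (hc _)) hhM)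
    · refine (m.degree_mul_le).trans ?_
      rw [m.degree_C, zero_add, hd]
    · rw [coeff_C_mul, h1, mul_one]
    · rw [map_sub, map_mul]
      exact sub_mem hg (L.mul_mem_left _ hhL)
    · intro a
      rw [coeff_sub, coeff_C_mul]
      exact sub_mem (hc a) (𝔞.mul_mem_right _ (hc _))

end GB

theorem mem_right_of_mul {R : Type*} [CommRing R] {I J : Ideal R} {x : R} (h : x ∈ I * J) : x ∈ J := by
  have h1 : I * J ≤ J := Ideal.mul_le_right
  exact h1 h

theorem mem_left_of_mul {R : Type*} [CommRing R] {I J : Ideal R} {x : R} (h : x ∈ I * J) : x ∈ I := by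
  have h1 : I * J ≤ I := Ideal.mul_le_left
  exact h1 h

section Red

variable {σ : Type*} (m : MonomialOrder σ) {K : Type*} [Field K]
variable {A : Type*} [CommRing A] (ι : A →+* K) (hι : Function.Injective ι)
variable {k : Type*} [Field k] (π : A →+* k) (hπ : Function.Surjective π)

/-- Reduction of an ideal. -/
noncomputable def red (I : Ideal (MvPolynomial σ K)) : Ideal (MvPolynomial σ k) :=
  (I.comap (map ι)).map (map π)

theorem red_mono {I J : Ideal (MvPolynomial σ K)} (h : I ≤ J) : red ι π I ≤ red ι π J :=
  Ideal.map_mono (Ideal.comap_mono h)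

theorem mem_red_of {I : Ideal (MvPolynomial σ K)} {g : MvPolynomial σ A} (hg : map ι g ∈ I) :
    map π g ∈ red ι π I :=
  Ideal.mem_map_of_mem _ hg

include hπ in
theorem mem_red {I : Ideal (MvPolynomial σ K)} {h : MvPolynomial σ k} :
    h ∈ red ι π I ↔ ∃ g, map ι g ∈ I ∧ map π g = h := by
  unfold red
  rw [Ideal.mem_map_iff_of_surjective _ (map_surjective π hπ)]
  rfl

theorem map_eq_zero_of_mem {M : Ideal (MvPolynomial σ A)} {g : MvPolynomial σ A}
    (hg : g ∈ (RingHom.ker π).map C * M) : map π g = 0 := by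
  have h1 : g ∈ (RingHom.ker π).map (C : A →+* MvPolynomial σ A) :=
    mem_left_of_mul hg
  have h2 : (RingHom.ker π).map (C : A →+* MvPolynomial σ A) ≤ RingHom.ker (map π) := by
    rw [Ideal.map_le_iff_le_comap]
    intro a ha
    rw [RingHom.mem_ker] at ha
    rw [Ideal.mem_comap, RingHom.mem_ker, map_C, ha, C_0]
  exact h2 h1

theorem degree_map_eq {g : MvPolynomial σ A} (h : coeff (m.degree g) (map π g) ≠ 0) :
    m.degree (map π g) = m.degree g := by
  apply m.toSyn.injective
  apply le_antisymm
  · rw [m.degree_le_iff]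
    intro b hb
    have hb' : b ∈ g.support := by
      rw [mem_support_iff, coeff_map] at hb
      rw [mem_support_iff]
      intro h0
      rw [h0, map_zero] at hb
      exact hb rfl
    exact m.le_degree hb'
  · apply m.le_degree
    rw [mem_support_iff]; exact h

include hι hπ in
theorem LT_red {L : Ideal (MvPolynomial σ K)} {G : Finset (MvPolynomial σ K)}
    (hG : IsGB m L G) (hM : ∀ g ∈ G, ∃ g', map ι g' = g) :
    LT m (red ι π L) = LT m L := by
  have hM' : ∀ g ∈ G, ∃ g' ∈ L.comap (map ι), map ι g' = g := by
    intro g hg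
    obtain ⟨g', rfl⟩ := hM g hg
    exact ⟨g', (hG.1 _ hg).1, rfl⟩
  apply Set.Subset.antisymm
  · rintro a ⟨h, hh, hh0, rfl⟩
    rw [mem_red ι π hπ] at hh
    obtain ⟨g, hg, rfl⟩ := hh
    revert g
    refine lead_induction m _ ?_ ?_
    · intro _ h; simp at h
    · intro g hg0 ih hg hh0
      obtain ⟨h, hhM, hhL, hd, h1⟩ := gb_head m ι hι hG hM' hg hg0
      set c := coeff (m.degree g) g with hcdef
      by_cases hc : π c = 0
      · have e : map π (g - C c * h) = map π g := by
          rw [map_sub, map_mul, map_C, hc, C_0, zero_mul, sub_zero]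
        have := ih (g - C c * h) (sub_support_lt m ?_ ?_) ?_ ?_
        · rwa [e] at this
        · refine (m.degree_mul_le).trans ?_
          rw [m.degree_C, zero_add, hd]
        · rw [coeff_C_mul, h1, mul_one]
        · rw [map_sub, map_mul]
          exact sub_mem hg (L.mul_mem_left _ hhL)
        · rwa [e]
      · have hd : m.degree (map π g) = m.degree g := by
          apply degree_map_eq
          rw [coeff_map]; exact hc
        rw [hd]
        refine ⟨map ι g, hg, ?_, degree_map_inj m ι hι g⟩
        rw [Ne, map_eq_zero_iff _ (map_injective ι hι)]; exact hg0
  · rintro a ⟨h, hh, hh0, rfl⟩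
    obtain ⟨u, hu, hud⟩ := hG.2 h hh hh0
    obtain ⟨v, hv, rfl⟩ := hM' u hu
    have hvm := monic_of_map m ι hι (hG.1 _ hu).2
    rw [degree_map_inj m ι hι] at hud
    refine LT_upper m ?_ hud
    have hc1 : coeff (m.degree v) (map π v) = 1 := by
      rw [coeff_map, hvm.coeff_degree, map_one]
    refine ⟨map π v, mem_red_of ι π hv, ?_, ?_⟩
    · intro h0
      rw [h0, coeff_zero] at hc1
      exact zero_ne_one hc1
    · apply degree_map_eq
      rw [hc1]; exact one_ne_zero

/-- lifting data for sums -/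
def SumLift (I J : Ideal (MvPolynomial σ K)) (G : Finset (MvPolynomial σ K)) : Prop :=
  ∀ g ∈ G, ∃ u v : MvPolynomial σ A, map ι u ∈ I ∧ map ι v ∈ J ∧ map ι (u + v) = g

theorem SumLift.lift {I J : Ideal (MvPolynomial σ K)} {G : Finset (MvPolynomial σ K)}
    (h : SumLift ι I J G) :
    ∀ g ∈ G, ∃ g' ∈ I.comap (map ι) ⊔ J.comap (map ι), map ι g' = g := by
  intro g hg
  obtain ⟨u, v, hu, hv, e⟩ := h g hg
  exact ⟨u + v, Submodule.add_mem_sup hu hv, e⟩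

include hι in
theorem red_sup {I J : Ideal (MvPolynomial σ K)} {G : Finset (MvPolynomial σ K)}
    (hG : IsGB m (I ⊔ J) G) (h : SumLift ι I J G) :
    red ι π (I ⊔ J) = red ι π I ⊔ red ι π J := by
  apply le_antisymm
  · unfold red
    rw [← Ideal.map_sup]
    apply Ideal.map_mono
    intro g hg
    have := gb_mem m ι hι hG h.lift ⊤ g hg (fun _ => trivial)
    exact mem_right_of_mul this
  · exact sup_le (red_mono ι π le_sup_left) (red_mono ι π le_sup_right)

include hι hπ in
theorem red_inf {I J : Ideal (MvPolynomial σ K)} {G : Finset (MvPolynomial σ K)}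
    (hG : IsGB m (I ⊔ J) G) (h : SumLift ι I J G) :
    red ι π (I ⊓ J) = red ι π I ⊓ red ι π J := by
  apply le_antisymm
  · exact le_inf (red_mono ι π inf_le_left) (red_mono ι π inf_le_right)
  · rintro w ⟨hw1, hw2⟩
    obtain ⟨u, hu, rfl⟩ := (mem_red ι π hπ).1 hw1
    obtain ⟨v, hv, e⟩ := (mem_red ι π hπ).1 hw2
    have := gb_mem m ι hι hG h.lift (RingHom.ker π) (u - v) ?_ ?_
    · rw [Ideal.mul_sup] at this
      obtain ⟨i, hi, j, hj, hij⟩ := Submodule.mem_sup.1 this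
      have e1 : u - i = v + j := by linear_combination -hij
      have hi' : map ι i ∈ I := (mem_right_of_mul hi : i ∈ I.comap (map ι))
      have hj' : map ι j ∈ J := (mem_right_of_mul hj : j ∈ J.comap (map ι))
      refine (mem_red ι π hπ).2 ⟨u - i, ⟨?_, ?_⟩, ?_⟩
      · rw [map_sub]; exact sub_mem hu hi'
      · rw [e1, map_add]; exact add_mem hv hj'
      · rw [map_sub, map_eq_zero_of_mem π hi, sub_zero]
    · rw [map_sub]
      exact sub_mem (Ideal.mem_sup_left hu) (Ideal.mem_sup_right hv)
    · intro a
      rw [RingHom.mem_ker, ← coeff_map, map_sub, e, sub_self, coeff_zero]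

include hι hπ in
theorem red_colon {I : Ideal (MvPolynomial σ K)} {j : MvPolynomial σ A}
    {G : Finset (MvPolynomial σ K)}
    (hG : IsGB m (I ⊔ Ideal.span {map ι j}) G)
    (h : ∀ g ∈ G, ∃ u v : MvPolynomial σ A, map ι u ∈ I ∧ map ι (u + v * j) = g) :
    red ι π (I.colon {map ι j}) = (red ι π I).colon {map π j} := by
  have hlift : ∀ g ∈ G, ∃ g' ∈ I.comap (map ι) ⊔ Ideal.span {j}, map ι g' = g := by
    intro g hg
    obtain ⟨u, v, hu, e⟩ := h g hg
    exact ⟨u + v * j, Submodule.add_mem_sup hu (Ideal.mem_span_singleton'.2 ⟨v, rfl⟩), e⟩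
  apply le_antisymm
  · intro w hw
    obtain ⟨u, hu, rfl⟩ := (mem_red ι π hπ).1 hw
    rw [Submodule.mem_colon_singleton, smul_eq_mul, ← map_mul] at hu ⊢
    exact mem_red_of ι π hu
  · intro w hw
    obtain ⟨u, rfl⟩ := map_surjective π hπ w
    rw [Submodule.mem_colon_singleton, smul_eq_mul, ← map_mul] at hw
    obtain ⟨v, hv, e⟩ := (mem_red ι π hπ).1 hw
    have := gb_mem m ι hι hG hlift (RingHom.ker π) (u * j - v) ?_ ?_
    · rw [Ideal.mul_sup] at this
      obtain ⟨i, hi, l, hl, hij⟩ := Submodule.mem_sup.1 this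
      have hi' : map ι i ∈ I := (mem_right_of_mul hi : i ∈ I.comap (map ι))
      obtain ⟨z, hz, rfl⟩ := Ideal.mem_mul_span_singleton.1 hl
      have hz0 : map π z = 0 := map_eq_zero_of_mem (M := ⊤) π (by rwa [Ideal.mul_top])
      refine (mem_red ι π hπ).2 ⟨u - z, ?_, ?_⟩
      · rw [Submodule.mem_colon_singleton, smul_eq_mul, ← map_mul]
        have : (u - z) * j = v + i := by linear_combination -hij
        rw [this, map_add]
        exact add_mem hv hi'
      · rw [map_sub, hz0, sub_zero]
    · rw [map_sub, map_mul]
      exact sub_mem (Ideal.mem_sup_right (Ideal.mem_span_singleton'.2 ⟨_, rfl⟩))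
        (Ideal.mem_sup_left hv)
    · intro a
      rw [RingHom.mem_ker, ← coeff_map, map_sub, e, sub_self, coeff_zero]

end Red

section Frob

variable {σ : Type*} [Finite σ] (m : MonomialOrder σ) {k : Type*} [Field k]
variable (p : ℕ) [hp : Fact p.Prime] [CharP k p] (s : k →+* k)

/-- the all-ones exponent -/
noncomputable def onesE (σ : Type*) [Finite σ] : σ →₀ ℕ := Finsupp.equivFunOnFinite.symm (fun _ => 1)

@[simp] theorem onesE_apply (i : σ) : onesE σ i = 1 := rfl

include hp in
theorem shift_inj : Function.Injective
    (fun a : σ →₀ ℕ => p • a + (p - 1) • onesE σ) := by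
  intro a b h
  ext i
  have := DFunLike.congr_fun h i
  simp only [Finsupp.add_apply, Finsupp.smul_apply, smul_eq_mul, add_left_inj] at this
  exact Nat.eq_of_mul_eq_mul_left hp.out.pos this

/-- The Frobenius trace -/
noncomputable def tr (h : MvPolynomial σ k) : MvPolynomial σ k :=
  map s (AddMonoidAlgebra.ofCoeff (Finsupp.comapDomain
    (fun a : σ →₀ ℕ => p • a + (p - 1) • onesE σ)
    (AddMonoidAlgebra.coeff h) (shift_inj p).injOn))

omit [CharP k p] in
theorem coeff_tr (h : MvPolynomial σ k) (a : σ →₀ ℕ) :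
    coeff a (tr p s h) = s (coeff (p • a + (p - 1) • onesE σ) h) := by
  unfold tr
  rw [coeff_map]
  rfl

omit [CharP k p] in
theorem tr_add (g h : MvPolynomial σ k) : tr p s (g + h) = tr p s g + tr p s h := by
  ext a
  simp only [coeff_tr, coeff_add, map_add]

theorem tr_pow_mul (hs : ∀ x, s (x ^ p) = x) (g h : MvPolynomial σ k) :
    tr p s (g ^ p * h) = g * tr p s h := by
  induction g using MvPolynomial.induction_on' with
  | add g1 g2 h1 h2 => rw [add_pow_char, add_mul, tr_add, h1, h2, add_mul]
  | monomial u c =>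
    ext a
    rw [coeff_tr, monomial_pow, coeff_monomial_mul', coeff_monomial_mul', coeff_tr]
    have hpos := hp.out.pos
    have hiff : p • u ≤ p • a + (p - 1) • onesE σ ↔ u ≤ a := by
      constructor
      · intro hle i
        have := hle i
        simp only [Finsupp.add_apply, Finsupp.smul_apply, smul_eq_mul, onesE_apply, mul_one] at this
        by_contra hlt
        have h3 : p * (a i + 1) ≤ p * u i := Nat.mul_le_mul_left _ (by omega)
        rw [mul_add] at h3
        omega
      · intro hle i
        have := Nat.mul_le_mul_left p (hle i)
        simp only [Finsupp.add_apply, Finsupp.smul_apply, smul_eq_mul]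
        omega
    by_cases hle : u ≤ a
    · rw [if_pos (hiff.2 hle), if_pos hle, map_mul, hs]
      congr 3
      obtain ⟨b, rfl⟩ := exists_add_of_le hle
      rw [add_tsub_cancel_left, smul_add, add_assoc, add_tsub_cancel_left]
    · rw [if_neg (fun h => hle (hiff.1 h)), if_neg hle, map_zero]

/-- compatibility with the splitting given by F -/
def Compat (F : MvPolynomial σ k) (I : Ideal (MvPolynomial σ k)) : Prop :=
  ∀ g ∈ I, tr p s (F ^ (p - 1) * g) ∈ I

variable {F : MvPolynomial σ k} {I J : Ideal (MvPolynomial σ k)}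

omit [CharP k p] in
theorem Compat.sup (hI : Compat p s F I) (hJ : Compat p s F J) : Compat p s F (I ⊔ J) := by
  intro g hg
  obtain ⟨u, hu, v, hv, rfl⟩ := Submodule.mem_sup.1 hg
  rw [mul_add, tr_add]
  exact Submodule.add_mem_sup (hI u hu) (hJ v hv)

omit [CharP k p] in
theorem Compat.inf (hI : Compat p s F I) (hJ : Compat p s F J) : Compat p s F (I ⊓ J) :=
  fun g hg => ⟨hI g hg.1, hJ g hg.2⟩

theorem Compat.colon (hs : ∀ x, s (x ^ p) = x) (hI : Compat p s F I) (j : MvPolynomial σ k) :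
    Compat p s F (I.colon {j}) := by
  intro g hg
  rw [Submodule.mem_colon_singleton, smul_eq_mul] at hg ⊢
  have e : tr p s (F ^ (p - 1) * g) * j = tr p s (F ^ (p - 1) * (j ^ (p - 1) * (g * j))) := by
    rw [mul_comm, ← tr_pow_mul p s hs]
    congr 1
    have : j ^ p = j ^ (p - 1) * j := by
      rw [← pow_succ, Nat.sub_add_cancel hp.out.pos]
    rw [this]; ring
  rw [e]
  exact hI _ (I.mul_mem_left _ hg)

theorem Compat.base (hs : ∀ x, s (x ^ p) = x) (f q : MvPolynomial σ k) :
    Compat p s (q * f) (Ideal.span {f}) := by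
  intro g hg
  obtain ⟨r, rfl⟩ := Ideal.mem_span_singleton'.1 hg
  have : (q * f) ^ (p - 1) * (r * f) = f ^ p * (q ^ (p - 1) * r) := by
    have : f ^ p = f ^ (p - 1) * f := by
      rw [← pow_succ, Nat.sub_add_cancel hp.out.pos]
    rw [this, mul_pow]; ring
  rw [this, tr_pow_mul p s hs]
  exact Ideal.mem_span_singleton'.2 ⟨_, mul_comm _ _⟩

omit [CharP k p] in
theorem Compat.LT_div (hF0 : F ≠ 0) (hF : m.degree F = onesE σ) (hI : Compat p s F I)
    {a : σ →₀ ℕ} (ha : p • a ∈ LT m I) : a ∈ LT m I := by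
  obtain ⟨g, hg, hg0, hd⟩ := ha
  have hFp : F ^ (p - 1) ≠ 0 := pow_ne_zero _ hF0
  have hdeg : m.degree (F ^ (p - 1) * g) = p • a + (p - 1) • onesE σ := by
    rw [m.degree_mul hFp hg0, m.degree_pow, hF, hd, add_comm]
  have hc : coeff a (tr p s (F ^ (p - 1) * g)) ≠ 0 := by
    rw [coeff_tr, ← hdeg]
    rw [Ne, map_eq_zero]
    rw [m.coeff_degree_eq_zero_iff]
    exact mul_ne_zero hFp hg0
  refine ⟨_, hI g hg, fun h0 => hc (by rw [h0, coeff_zero]), ?_⟩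
  apply m.toSyn.injective
  apply le_antisymm
  · rw [m.degree_le_iff]
    intro b hb
    by_contra hlt
    rw [not_le] at hlt
    rw [mem_support_iff, coeff_tr] at hb
    apply hb
    rw [m.coeff_eq_zero_of_lt, map_zero]
    rw [hdeg, map_add, map_add, map_nsmul, map_nsmul]
    rw [map_nsmul]
    exact add_lt_add_left (nsmul_lt_nsmul_right hp.out.ne_zero hlt) _
  · apply m.le_degree
    rw [mem_support_iff]; exact hc

omit [CharP k p] in
theorem Compat.LT_sqfree (hF0 : F ≠ 0) (hF : m.degree F = onesE σ) (hI : Compat p s F I)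
    {a b : σ →₀ ℕ} (ha : a ∈ LT m I) (hb : ∀ i, a i ≠ 0 → b i ≠ 0) : b ∈ LT m I := by
  obtain ⟨e, he⟩ : ∃ e : ℕ, ∀ i, a i ≤ p ^ e := by
    refine ⟨a.degree, fun i => ?_⟩
    exact (Finsupp.le_degree i a).trans (Nat.lt_pow_self hp.out.one_lt).le
  have h1 : p ^ e • b ∈ LT m I := by
    refine LT_upper m ha fun i => ?_
    simp only [Finsupp.smul_apply, smul_eq_mul]
    by_cases hi : a i = 0
    · rw [hi]; exact Nat.zero_le _
    · exact (he i).trans (Nat.le_mul_of_pos_right _ (Nat.pos_of_ne_zero (hb i hi)))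
  clear he
  induction e with
  | zero => simpa using h1
  | succ e ih =>
    apply ih
    apply hI.LT_div m p s hF0 hF
    rwa [smul_smul, mul_comm, ← pow_succ]

end Frob

section Main

universe u v

variable {σ : Type v} [Finite σ] (m : MonomialOrder σ) {K : Type u} [Field K]

theorem exists_lift {A : Type*} [CommRing A] (ι : A →+* K) {P : MvPolynomial σ K} {T : Finset K}
    (hP : P.coeffs ⊆ T) (hT : (T : Set K) ⊆ Set.range ι) : ∃ P', map ι P' = P := by
  have := (mem_range_map_iff_coeffs_subset (f := ι) (x := P)).2
    (fun x hx => hT (Finset.mem_coe.2 (hP (Finset.mem_coe.1 hx))))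
  exact this

/-- The reductions of `I` are compatible, for every sufficiently large coefficient ring. -/
def Good (F : MvPolynomial σ K) (I : Ideal (MvPolynomial σ K)) : Prop :=
  ∃ T : Finset K, ∀ (A k : Type u) [CommRing A] [Field k] (ι : A →+* K)
    (_ : Function.Injective ι) (π : A →+* k) (_ : Function.Surjective π)
    (p : ℕ) [Fact p.Prime] [CharP k p] (s : k →+* k) (_ : ∀ x, s (x ^ p) = x),
    (T : Set K) ⊆ Set.range ι → ∀ F' : MvPolynomial σ A, map ι F' = F →
      Compat p s (map π F') (red ι π I)

theorem exists_sum_data (I J : Ideal (MvPolynomial σ K)) :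
    ∃ (G : Finset (MvPolynomial σ K)) (T : Finset K), IsGB m (I ⊔ J) G ∧
      ∀ (A : Type u) [CommRing A] (ι : A →+* K), (T : Set K) ⊆ Set.range ι → SumLift ι I J G := by
  classical
  obtain ⟨G, hG⟩ := exists_gb m (I ⊔ J)
  have h1 : ∀ g ∈ G, ∃ u v : MvPolynomial σ K, u ∈ I ∧ v ∈ J ∧ u + v = g := by
    intro g hg
    obtain ⟨u, hu, v, hv, e⟩ := Submodule.mem_sup.1 (hG.1 g hg).1
    exact ⟨u, v, hu, hv, e⟩
  choose! u v hu hv e using h1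
  refine ⟨G, G.biUnion (fun g => (u g).coeffs ∪ (v g).coeffs), hG, ?_⟩
  intro A _ ι hT g hg
  have hs : (u g).coeffs ∪ (v g).coeffs ⊆ G.biUnion (fun g => (u g).coeffs ∪ (v g).coeffs) :=
    Finset.subset_biUnion_of_mem (fun g => (u g).coeffs ∪ (v g).coeffs) hg
  obtain ⟨u', hu'⟩ := exists_lift ι (Finset.union_subset_left hs) hT
  obtain ⟨v', hv'⟩ := exists_lift ι (Finset.union_subset_right hs) hT
  refine ⟨u', v', ?_, ?_, ?_⟩
  · rw [hu']; exact hu g hg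
  · rw [hv']; exact hv g hg
  · rw [map_add, hu', hv']; exact e g hg

theorem exists_colon_data (I : Ideal (MvPolynomial σ K)) (j : MvPolynomial σ K) :
    ∃ (G : Finset (MvPolynomial σ K)) (T : Finset K), IsGB m (I ⊔ Ideal.span {j}) G ∧
      ∀ (A : Type u) [CommRing A] (ι : A →+* K), (T : Set K) ⊆ Set.range ι →
        ∀ g ∈ G, ∃ u v : MvPolynomial σ A, map ι u ∈ I ∧ map ι u + map ι v * j = g := by
  classical
  obtain ⟨G, hG⟩ := exists_gb m (I ⊔ Ideal.span {j})
  have h1 : ∀ g ∈ G, ∃ u v : MvPolynomial σ K, u ∈ I ∧ u + v * j = g := by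
    intro g hg
    obtain ⟨u, hu, v, hv, e⟩ := Submodule.mem_sup.1 (hG.1 g hg).1
    obtain ⟨w, rfl⟩ := Ideal.mem_span_singleton'.1 hv
    exact ⟨u, w, hu, e⟩
  choose! u v hu e using h1
  refine ⟨G, G.biUnion (fun g => (u g).coeffs ∪ (v g).coeffs), hG, ?_⟩
  intro A _ ι hT g hg
  have hs : (u g).coeffs ∪ (v g).coeffs ⊆ G.biUnion (fun g => (u g).coeffs ∪ (v g).coeffs) :=
    Finset.subset_biUnion_of_mem (fun g => (u g).coeffs ∪ (v g).coeffs) hg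
  obtain ⟨u', hu'⟩ := exists_lift ι (Finset.union_subset_left hs) hT
  obtain ⟨v', hv'⟩ := exists_lift ι (Finset.union_subset_right hs) hT
  refine ⟨u', v', ?_, ?_⟩
  · rw [hu']; exact hu g hg
  · rw [hu', hv']; exact e g hg

variable {F : MvPolynomial σ K} {I J : Ideal (MvPolynomial σ K)}

include m in
theorem Good.sup (hI : Good F I) (hJ : Good F J) : Good F (I ⊔ J) := by
  classical
  obtain ⟨T1, h1⟩ := hI
  obtain ⟨T2, h2⟩ := hJ
  obtain ⟨G, T3, hG, h3⟩ := exists_sum_data m I J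
  refine ⟨T1 ∪ T2 ∪ T3, ?_⟩
  intro A k _ _ ι hι π hπ p _ _ s hs hT F' hF'
  simp only [Finset.coe_union, Set.union_subset_iff] at hT
  rw [red_sup m ι hι π hG (h3 A ι hT.2)]
  exact (h1 A k ι hι π hπ p s hs hT.1.1 F' hF').sup p s (h2 A k ι hι π hπ p s hs hT.1.2 F' hF')

include m in
theorem Good.inf (hI : Good F I) (hJ : Good F J) : Good F (I ⊓ J) := by
  classical
  obtain ⟨T1, h1⟩ := hI
  obtain ⟨T2, h2⟩ := hJ
  obtain ⟨G, T3, hG, h3⟩ := exists_sum_data m I J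
  refine ⟨T1 ∪ T2 ∪ T3, ?_⟩
  intro A k _ _ ι hι π hπ p _ _ s hs hT F' hF'
  simp only [Finset.coe_union, Set.union_subset_iff] at hT
  rw [red_inf m ι hι π hπ hG (h3 A ι hT.2)]
  exact (h1 A k ι hι π hπ p s hs hT.1.1 F' hF').inf p s (h2 A k ι hι π hπ p s hs hT.1.2 F' hF')

include m in
theorem Good.colon_singleton (hI : Good F I) (j : MvPolynomial σ K) : Good F (I.colon {j}) := by
  classical
  obtain ⟨T1, h1⟩ := hI
  obtain ⟨G, T3, hG, h3⟩ := exists_colon_data m I j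
  refine ⟨T1 ∪ j.coeffs ∪ T3, ?_⟩
  intro A k _ _ ι hι π hπ p _ _ s hs hT F' hF'
  simp only [Finset.coe_union, Set.union_subset_iff] at hT
  obtain ⟨j', rfl⟩ := exists_lift ι (Finset.Subset.refl _) hT.1.2
  rw [red_colon m ι hι π hπ hG]
  · exact (h1 A k ι hι π hπ p s hs hT.1.1 F' hF').colon p s hs _
  · intro g hg
    obtain ⟨u, v, hu, e⟩ := h3 A ι hT.2 g hg
    exact ⟨u, v, hu, by rw [map_add, map_mul]; exact e⟩

theorem Good.top : Good F (⊤ : Ideal (MvPolynomial σ K)) := by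
  refine ⟨∅, ?_⟩
  intro A k _ _ ι hι π hπ p _ _ s hs hT F' hF' g hg
  have : red ι π (⊤ : Ideal (MvPolynomial σ K)) = ⊤ := by
    unfold red
    rw [Ideal.comap_top, Ideal.map_top]
  rw [this]; trivial

include m in
theorem Good.colon_finset (hI : Good F I) (S : Finset (MvPolynomial σ K)) :
    Good F (I.colon (S : Set (MvPolynomial σ K))) := by
  classical
  induction S using Finset.induction_on with
  | empty =>
    have : I.colon ((∅ : Finset (MvPolynomial σ K)) : Set (MvPolynomial σ K)) = ⊤ := by
      rw [eq_top_iff]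
      intro x _
      rw [Submodule.mem_colon]
      intro y hy
      simp at hy
    rw [this]; exact Good.top
  | insert a S _ ih =>
    have : I.colon ((insert a S : Finset (MvPolynomial σ K)) : Set (MvPolynomial σ K)) =
        I.colon {a} ⊓ I.colon (S : Set (MvPolynomial σ K)) := by
      ext x
      rw [Submodule.mem_inf, Submodule.mem_colon, Submodule.mem_colon_singleton,
        Submodule.mem_colon]
      simp only [Finset.mem_coe, Finset.mem_insert, forall_eq_or_imp]
    rw [this]
    exact Good.inf m (hI.colon_singleton m a) ih

include m in
theorem Good.colon (hI : Good F I) (J : Ideal (MvPolynomial σ K)) :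
    Good F (I.colon (J : Set (MvPolynomial σ K))) := by
  obtain ⟨S, hS⟩ := (isNoetherian_def.1 (inferInstance : IsNoetherianRing (MvPolynomial σ K))) J
  have : I.colon (J : Set (MvPolynomial σ K)) = I.colon (S : Set (MvPolynomial σ K)) := by
    rw [← hS]
    ext x
    rw [Submodule.mem_colon, Submodule.mem_colon]
    refine ⟨fun h y hy => h y (Submodule.subset_span hy), fun h y hy => ?_⟩
    have hle : Submodule.span (MvPolynomial σ K) (S : Set (MvPolynomial σ K)) ≤ I.colon {x} := by
      rw [Submodule.span_le]
      intro z hz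
      have := h z hz
      rw [SetLike.mem_coe, Submodule.mem_colon_singleton, smul_eq_mul, mul_comm]
      exact this
    have := hle hy
    rw [Submodule.mem_colon_singleton, smul_eq_mul, mul_comm] at this
    exact this
  rw [this]
  exact hI.colon_finset m S

theorem Good.base {f1 : MvPolynomial σ K} (hf : m.Monic f1) (q : MvPolynomial σ K) :
    Good (q * f1) (Ideal.span {f1}) := by
  classical
  refine ⟨f1.coeffs ∪ q.coeffs, ?_⟩
  intro A k _ _ ι hι π hπ p _ _ s hs hT F' hF'
  simp only [Finset.coe_union, Set.union_subset_iff] at hT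
  obtain ⟨f', rfl⟩ := exists_lift ι (Finset.Subset.refl _) hT.1
  obtain ⟨q', rfl⟩ := exists_lift ι (Finset.Subset.refl _) hT.2
  have hFF : F' = q' * f' := by
    apply map_injective ι hι
    rw [hF', map_mul]
  have hG : IsGB m (Ideal.span {map ι f'}) {map ι f'} := by
    constructor
    · intro g hg
      rw [Finset.mem_singleton] at hg
      subst hg
      exact ⟨Ideal.mem_span_singleton_self _, hf⟩
    · intro h hh hh0
      obtain ⟨r, rfl⟩ := Ideal.mem_span_singleton'.1 hh
      refine ⟨_, Finset.mem_singleton_self _, ?_⟩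
      rw [m.degree_mul (left_ne_zero_of_mul hh0) (right_ne_zero_of_mul hh0)]
      exact le_add_self
  have hred : red ι π (Ideal.span {map ι f'}) = Ideal.span {map π f'} := by
    apply le_antisymm
    · intro w hw
      obtain ⟨g, hg, rfl⟩ := (mem_red ι π hπ).1 hw
      have := gb_mem m ι hι hG (M := Ideal.span {f'}) ?_ ⊤ g hg (fun _ => trivial)
      · obtain ⟨r, rfl⟩ := Ideal.mem_span_singleton'.1 (mem_right_of_mul this)
        rw [map_mul]
        exact Ideal.mem_span_singleton'.2 ⟨_, rfl⟩
      · intro g hg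
        rw [Finset.mem_singleton] at hg
        exact ⟨f', Ideal.mem_span_singleton_self _, hg.symm⟩
    · rw [Ideal.span_singleton_le_iff_mem]
      exact mem_red_of ι π (Ideal.mem_span_singleton_self _)
  rw [hred, hFF, map_mul]
  exact Compat.base p s hs _ _

theorem isJacobsonRing_int : IsJacobsonRing ℤ := by
  rw [isJacobsonRing_iff_prime_eq]
  intro P hP
  by_cases h : P = ⊥
  · subst h
    rw [eq_bot_iff]
    intro x hx
    rw [Ideal.mem_jacobson_bot] at hx
    have h1 := hx x
    rw [Int.isUnit_iff] at h1
    rw [Ideal.mem_bot]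
    rcases h1 with h1 | h1
    · nlinarith
    · nlinarith [mul_self_nonneg x]
  · have : P.IsMaximal := hP.isMaximal h
    exact Ideal.jacobson_eq_self_of_isMaximal

theorem exists_char_perfect {A : Type*} [CommRing A] [Algebra.FiniteType ℤ A]
    {k : Type*} [Field k] (π : A →+* k) (hπ : Function.Surjective π) :
    ∃ p : ℕ, Fact p.Prime ∧ CharP k p ∧ ∃ s : k →+* k, ∀ x, s (x ^ p) = x := by
  have hJ := isJacobsonRing_int
  have : Algebra.FiniteType ℤ k := Algebra.FiniteType.of_surjective π.toIntAlgHom hπ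
  have hfin : Module.Finite ℤ k := finite_of_finite_type_of_isJacobsonRing ℤ k
  have hnz : ¬ CharZero k := by
    intro _
    have hInt : Algebra.IsIntegral ℤ k := inferInstance
    have := isField_of_isIntegral_of_isField (R := ℤ) (S := k)
      (algebraMap ℤ k).injective_int (Field.toIsField k)
    exact Int.not_isField this
  obtain ⟨p, hp⟩ := CharP.exists k
  have hp0 : p ≠ 0 := by
    rintro rfl
    exact hnz (CharP.charP_to_charZero k)
  have hpp : p.Prime := (CharP.char_is_prime_or_zero k p).resolve_right hp0
  have : Fact p.Prime := ⟨hpp⟩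
  let : Algebra (ZMod p) k := ZMod.algebra k p
  have : Module.Finite (ZMod p) k := Module.Finite.of_restrictScalars_finite ℤ (ZMod p) k
  have : Finite k := Module.finite_of_finite (ZMod p)
  refine ⟨p, ⟨hpp⟩, hp, ((frobeniusEquiv k p).symm : k →+* k), fun x => ?_⟩
  exact frobeniusEquiv_symm_pow k p x

theorem Good.LT_sqfree (hF : m.Monic F) (hF1 : m.degree F = onesE σ) (hI : Good F I)
    {a b : σ →₀ ℕ} (ha : a ∈ LT m I) (hb : ∀ i, a i ≠ 0 → b i ≠ 0) : b ∈ LT m I := by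
  classical
  obtain ⟨T, hT⟩ := hI
  obtain ⟨G, hG⟩ := exists_gb m I
  let T' : Finset K := T ∪ F.coeffs ∪ G.biUnion (fun g => g.coeffs)
  let A := Algebra.adjoin ℤ (T' : Set K)
  have : Algebra.FiniteType ℤ A := Algebra.FiniteType.adjoin_of_finite T'.finite_toSet
  let ι : A →+* K := A.val.toRingHom
  have hι : Function.Injective ι := Subtype.val_injective
  have hr : (T' : Set K) ⊆ Set.range ι := fun x hx => ⟨⟨x, Algebra.subset_adjoin hx⟩, rfl⟩
  obtain ⟨M, hM⟩ := Ideal.exists_maximal A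
  let : Field (A ⧸ M) := Ideal.Quotient.field M
  let π : A →+* (A ⧸ M) := Ideal.Quotient.mk M
  have hπ : Function.Surjective π := Ideal.Quotient.mk_surjective
  obtain ⟨p, _, _, s, hs⟩ := exists_char_perfect π hπ
  obtain ⟨F', hF'⟩ := exists_lift ι (T := T') (P := F)
    (fun x hx => Finset.mem_union_left _ (Finset.mem_union_right _ hx)) hr
  have hcomp := hT A (A ⧸ M) ι hι π hπ p s hs
    (fun x hx => hr (Finset.mem_union_left _ (Finset.mem_union_left _ hx))) F' hF'
  have hlift : ∀ g ∈ G, ∃ g', map ι g' = g := by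
    intro g hg
    refine exists_lift ι (T := T') ?_ hr
    intro x hx
    exact Finset.mem_union_right _ (Finset.mem_biUnion.2 ⟨g, hg, hx⟩)
  have hLT := LT_red m ι hι π hπ hG hlift
  have hm' : m.Monic F' := monic_of_map m ι hι (by rw [hF']; exact hF)
  have hc : coeff (m.degree F') (map π F') = 1 := by
    rw [coeff_map, hm'.coeff_degree, map_one]
  have hd : m.degree (map π F') = onesE σ := by
    rw [degree_map_eq m π (by rw [hc]; exact one_ne_zero), ← degree_map_inj m ι hι, hF', hF1]
  rw [← hLT] at ha ⊢
  refine hcomp.LT_sqfree m p s ?_ hd ha hb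
  intro h0
  rw [h0, coeff_zero] at hc
  exact zero_ne_one hc

end Main

section Final

variable {σ : Type*} (m : MonomialOrder σ) {K : Type*} [Field K]

theorem monomial_eq_prod [Finite σ] (s : Finset σ) (b : σ →₀ ℕ)
    (h0 : ∀ i ∉ s, b i = 0) (h1 : ∀ i ∈ s, b i = 1) :
    (monomial b (1 : K)) = ∏ i ∈ s, X i := by
  rw [monomial_eq, C_1, one_mul, Finsupp.prod_of_support_subset (s := s)]
  · apply Finset.prod_congr rfl
    intro i hi
    rw [h1 i hi, pow_one]
  · intro i hi
    by_contra hn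
    exact (Finsupp.mem_support_iff.1 hi) (h0 i hn)
  · intro i _; rw [pow_zero]

theorem sqfree_of_LT [Finite σ] (I : Ideal (MvPolynomial σ K))
    (h : ∀ a b : σ →₀ ℕ, a ∈ LT m I → (∀ i, a i ≠ 0 → b i ≠ 0) → b ∈ LT m I) :
    IsSqfreeMonomialIdeal (m.initialIdeal I) := by
  classical
  refine ⟨{g | ∃ s : Finset σ, g = ∏ i ∈ s, X i ∧ g ∈ m.initialIdeal I}, ?_, ?_⟩
  · rintro g ⟨s, rfl, _⟩
    exact ⟨s, rfl⟩
  · apply le_antisymm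
    · conv_lhs => unfold MonomialOrder.initialIdeal
      rw [Ideal.span_le]
      rintro _ ⟨f, hf, hf0, rfl⟩
      let b : σ →₀ ℕ := Finsupp.indicator (m.degree f).support (fun _ _ => 1)
      have hb0 : ∀ i ∉ (m.degree f).support, b i = 0 := fun i hi =>
        Finsupp.indicator_of_notMem hi _
      have hb1 : ∀ i ∈ (m.degree f).support, b i = 1 := fun i hi =>
        Finsupp.indicator_of_mem hi _
      have hbL : b ∈ LT m I := by
        refine h _ b ⟨f, hf, hf0, rfl⟩ fun i hi => ?_
        rw [hb1 i (Finsupp.mem_support_iff.2 hi)]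
        exact one_ne_zero
      obtain ⟨g, hg, hgm, hgd⟩ := exists_monic m hbL
      have hmem : monomial b (1 : K) ∈ m.initialIdeal I := by
        apply Ideal.subset_span
        refine ⟨g, hg, hgm.ne_zero, ?_⟩
        change _ = monomial (m.degree g) (coeff (m.degree g) g)
        rw [hgm.coeff_degree, hgd]
      rw [SetLike.mem_coe]
      have hbe := monomial_eq_prod (K := K) _ b hb0 hb1
      have hmul : m.leadTerm f =
          monomial (m.degree f - b) (coeff (m.degree f) f) * monomial b (1 : K) := by
        change monomial (m.degree f) (coeff (m.degree f) f) = _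
        rw [monomial_mul, mul_one, tsub_add_cancel_of_le]
        intro i
        by_cases hi : i ∈ (m.degree f).support
        · rw [hb1 i hi]
          exact Nat.pos_of_ne_zero (Finsupp.mem_support_iff.1 hi)
        · rw [hb0 i hi]; exact Nat.zero_le _
      rw [hmul]
      apply Ideal.mul_mem_left
      exact Ideal.subset_span ⟨_, hbe, hmem⟩
    · rw [Ideal.span_le]
      rintro g ⟨s, _, hg⟩
      exact hg

theorem radical_of_LT (I : Ideal (MvPolynomial σ K))
    (h : ∀ a b : σ →₀ ℕ, a ∈ LT m I → (∀ i, a i ≠ 0 → b i ≠ 0) → b ∈ LT m I) :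
    I.IsRadical := by
  intro g hg
  revert g
  refine lead_induction m _ ?_ ?_
  · intro _; exact zero_mem _
  · intro g hg0 ih hg
    obtain ⟨n, hn⟩ := hg
    have hL : m.degree g ∈ LT m I := by
      refine h _ _ ⟨g ^ n, hn, pow_ne_zero _ hg0, rfl⟩ fun i hi => ?_
      rw [m.degree_pow] at hi
      intro h0
      apply hi
      rw [Finsupp.smul_apply, h0, smul_zero]
    obtain ⟨w, hw, hwm, hwd⟩ := exists_monic m hL
    have hCw : C (coeff (m.degree g) g) * w ∈ I := I.mul_mem_left _ hw
    have hs := ih (g - C (coeff (m.degree g) g) * w) (sub_support_lt m ?_ ?_) ?_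
    · have := add_mem hs hCw
      rwa [sub_add_cancel] at this
    · refine (m.degree_mul_le).trans ?_
      rw [m.degree_C, zero_add, hwd]
    · rw [coeff_C_mul, ← hwd, hwm.coeff_degree, mul_one]
    · exact sub_mem ⟨n, hn⟩ (Ideal.le_radical hCw)

end Final

end KnutsonAux

/-- **Proposition (char 0).** Over a field of characteristic `0`, if `f` has squarefree
leading term and `I ∈ C_f`, then `lt(I)` is a squarefree monomial ideal;
in particular `I` is radical. -/
theorem knutson_initialIdeal_sqfree_charZero {n : ℕ} {K : Type*} [Field K] [CharZero K]
    (m : MonomialOrder (Fin n)) (f : MvPolynomial (Fin n) K)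
    (hf : m.HasSqfreeLeadTerm f)
    (I : Ideal (MvPolynomial (Fin n) K)) (hI : KnutsonFamily f I) :
    IsSqfreeMonomialIdeal (m.initialIdeal I) ∧ I.IsRadical := by

  obtain ⟨hf0, hsq⟩ := hf
  have hl : m.leadingCoeff f ≠ 0 := by rwa [m.leadingCoeff_ne_zero_iff]
  set f1 : MvPolynomial (Fin n) K := C (m.leadingCoeff f)⁻¹ * f with hf1
  have hC : (C (m.leadingCoeff f)⁻¹ : MvPolynomial (Fin n) K) ≠ 0 := by simpa using hf0
  have hmon : m.Monic f1 := by
    unfold MonomialOrder.Monic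
    rw [hf1, m.leadingCoeff_mul, m.leadingCoeff_C, inv_mul_cancel₀ hl]
  have hdeg : m.degree f1 = m.degree f := by
    rw [hf1, m.degree_mul hC hf0, m.degree_C, zero_add]
  have hspan : Ideal.span {f} = Ideal.span {f1} := by
    apply le_antisymm
    · rw [Ideal.span_singleton_le_iff_mem]
      refine Ideal.mem_span_singleton'.2 ⟨C (m.leadingCoeff f), ?_⟩
      rw [hf1, ← mul_assoc, ← C_mul, mul_inv_cancel₀ hl, C_1, one_mul]
    · rw [Ideal.span_singleton_le_iff_mem]
      exact Ideal.mem_span_singleton'.2 ⟨_, rfl⟩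
  have hle : m.degree f1 ≤ KnutsonAux.onesE (Fin n) := by
    rw [hdeg]
    intro i
    exact hsq i
  obtain ⟨hFd, hFc⟩ := KnutsonAux.monic_shift m hmon hle
  set F := monomial (KnutsonAux.onesE (Fin n) - m.degree f1) (1 : K) * f1 with hFdef
  have hFm : m.Monic F := by
    unfold MonomialOrder.Monic MonomialOrder.leadingCoeff
    rw [hFd, hFc]
  have hgood : KnutsonAux.Good F I := by
    induction hI with
    | base => rw [hspan]; exact KnutsonAux.Good.base m hmon _
    | colon I J _ ih => exact ih.colon m J
    | add I J _ _ ih1 ih2 => exact ih1.sup m ih2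
    | inter I J _ _ ih1 ih2 => exact ih1.inf m ih2
  have hLT : ∀ a b : Fin n →₀ ℕ, a ∈ KnutsonAux.LT m I → (∀ i, a i ≠ 0 → b i ≠ 0) →
      b ∈ KnutsonAux.LT m I := fun a b ha hb => hgood.LT_sqfree m hFm hFd ha hb
  exact ⟨KnutsonAux.sqfree_of_LT m I hLT, KnutsonAux.radical_of_LT m I hLT⟩
end

section
/- Let K be a field, S = K[x₁,…,xₙ] with a fixed term order ≺, and let C be a set of ideals of S that is closed under pairwise intersections and such that lt(I) is a squarefree monomial ideal for every I ∈ C. Then for all I, J ∈ C one has lt(I ∩ J) = lt(I) ∩ lt(J). -/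
open MvPolynomial

theorem MonomialOrder.mem_initialIdeal_iff_aux {σ : Type*} {K : Type*} [Field K]
    (m : MonomialOrder σ) (I : Ideal (MvPolynomial σ K)) (p : MvPolynomial σ K) :
    p ∈ m.initialIdeal I ↔ ∀ d ∈ p.support, ∃ f ∈ I, f ≠ 0 ∧ m.degree f ≤ d := by
  have key : m.initialIdeal I = Ideal.span
      ((fun s => monomial s (1 : K)) '' {d | ∃ f ∈ I, f ≠ 0 ∧ m.degree f = d}) := by
    apply le_antisymm
    · refine Ideal.span_le.2 ?_
      rintro g ⟨f, hf, h0, rfl⟩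
      have : m.leadTerm f = C (f.coeff (m.degree f)) * monomial (m.degree f) 1 := by
        rw [C_mul_monomial, mul_one]; rfl
      rw [this]
      exact Ideal.mul_mem_left _ _ (Ideal.subset_span ⟨_, ⟨f, hf, h0, rfl⟩, rfl⟩)
    · refine Ideal.span_le.2 ?_
      rintro g ⟨d, ⟨f, hf, h0, rfl⟩, rfl⟩
      have hc : f.coeff (m.degree f) ≠ 0 := m.leadingCoeff_ne_zero_iff.2 h0
      have : (monomial (m.degree f) (1 : K)) =
          C (f.coeff (m.degree f))⁻¹ * m.leadTerm f := by
        change _ = C (f.coeff (m.degree f))⁻¹ * monomial (m.degree f) (f.coeff (m.degree f))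
        rw [C_mul_monomial, inv_mul_cancel₀ hc]
      change monomial (m.degree f) (1 : K) ∈ m.initialIdeal I
      rw [this]
      exact Ideal.mul_mem_left _ _ (Ideal.subset_span ⟨f, hf, h0, rfl⟩)
  rw [key, mem_ideal_span_monomial_image]
  constructor
  · intro h d hd
    obtain ⟨_, ⟨f, hf, h0, rfl⟩, hle⟩ := h d hd
    exact ⟨f, hf, h0, hle⟩
  · intro h d hd
    obtain ⟨f, hf, h0, hle⟩ := h d hd
    exact ⟨_, ⟨f, hf, h0, rfl⟩, hle⟩

theorem IsSqfreeMonomialIdeal.exists_exponents {σ : Type*} {K : Type*} [Field K]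
    {J : Ideal (MvPolynomial σ K)} (h : IsSqfreeMonomialIdeal J) :
    ∃ D : Set (σ →₀ ℕ), (∀ d ∈ D, ∀ i, d i ≤ 1) ∧
      J = Ideal.span ((fun s => monomial s (1 : K)) '' D) := by
  classical
  obtain ⟨G, hG, rfl⟩ := h
  refine ⟨{d | (∀ i, d i ≤ 1) ∧ monomial d (1 : K) ∈ G}, fun d hd => hd.1, ?_⟩
  congr 1
  ext g
  constructor
  · intro hg
    obtain ⟨s, rfl⟩ := hG g hg
    have e : (∏ i ∈ s, X i : MvPolynomial σ K) =
        monomial (∑ i ∈ s, Finsupp.single i 1) 1 := by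
      rw [monomial_sum_one]; rfl
    refine ⟨∑ i ∈ s, Finsupp.single i 1, ⟨fun j => ?_, e ▸ hg⟩, e.symm⟩
    rw [Finsupp.finset_sum_apply]
    simp only [Finsupp.single_apply, Finset.sum_ite_eq']
    split_ifs <;> simp
  · rintro ⟨d, hd, rfl⟩
    exact hd.2

/-- **Remark (part 1).** If `C` is a family of ideals closed under pairwise intersections whose
members all have squarefree initial ideal, then `lt(I ∩ J) = lt(I) ∩ lt(J)` for `I, J ∈ C`. -/
theorem initialIdeal_inf_of_sqfree_family {n : ℕ} {K : Type*} [Field K]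
    (m : MonomialOrder (Fin n)) (C : Set (Ideal (MvPolynomial (Fin n) K)))
    (hC : ∀ I ∈ C, ∀ J ∈ C, I ⊓ J ∈ C)
    (hsq : ∀ I ∈ C, IsSqfreeMonomialIdeal (m.initialIdeal I)) :
    ∀ I ∈ C, ∀ J ∈ C, m.initialIdeal (I ⊓ J) = m.initialIdeal I ⊓ m.initialIdeal J := by
  intro I hI J hJ
  ext p
  rw [Ideal.mem_inf]
  simp only [m.mem_initialIdeal_iff_aux I, m.mem_initialIdeal_iff_aux J]
  constructor
  · rw [m.mem_initialIdeal_iff_aux]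
    intro h
    constructor
    · intro d hd
      obtain ⟨f, hf, h0⟩ := h d hd
      exact ⟨f, hf.1, h0⟩
    · intro d hd
      obtain ⟨f, hf, h0⟩ := h d hd
      exact ⟨f, hf.2, h0⟩
  · rintro ⟨h1, h2⟩
    obtain ⟨D, hD, hspan⟩ := (hsq _ (hC I hI J hJ)).exists_exponents
    rw [hspan, mem_ideal_span_monomial_image]
    intro d hd
    obtain ⟨f, hf, hf0, hfd⟩ := h1 d hd
    obtain ⟨g, hg, hg0, hgd⟩ := h2 d hd
    have hmem : monomial (d + d) (1 : K) ∈ m.initialIdeal (I ⊓ J) := by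
      rw [m.mem_initialIdeal_iff_aux]
      intro e he
      have hed : e = d + d := by
        simpa using support_monomial_subset he
      subst hed
      refine ⟨f * g, ⟨Ideal.mul_mem_right _ _ hf, Ideal.mul_mem_left _ _ hg⟩,
        mul_ne_zero hf0 hg0, ?_⟩
      rw [m.degree_mul hf0 hg0]
      exact add_le_add hfd hgd
    rw [hspan, mem_ideal_span_monomial_image] at hmem
    obtain ⟨s, hs, hle⟩ := hmem (d + d) (by simp [mem_support_iff, coeff_monomial])
    refine ⟨s, hs, fun i => ?_⟩
    have ha := hD s hs i
    have hb := hle i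
    rw [Finsupp.add_apply] at hb
    omega
end

section
/- Let K be a field, S = K[x₁,…,xₙ] with a fixed term order ≺, and let C be a set of ideals of S that is closed under pairwise intersections and such that lt(I) is a squarefree monomial ideal for every I ∈ C. Then the map I ↦ lt(I) is injective on C, and consequently C is a finite set. -/
open MvPolynomial

theorem aux_degreeOf_eq {σ K : Type*} [CommSemiring K] (m : MonomialOrder σ)
    (f : MvPolynomial σ K) : m.degreeOf f = m.degree f := rfl

/-- Exponents of leading terms of nonzero elements of `I`. -/
def auxExps {σ K : Type*} [Field K] (m : MonomialOrder σ)
    (I : Ideal (MvPolynomial σ K)) : Set (σ →₀ ℕ) :=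
  {d | ∃ f ∈ I, f ≠ 0 ∧ m.degree f = d}

theorem aux_initialIdeal {σ K : Type*} [Field K] (m : MonomialOrder σ)
    (I : Ideal (MvPolynomial σ K)) :
    m.initialIdeal I = Ideal.span ((fun s => monomial s (1 : K)) '' auxExps m I) := by
  apply le_antisymm
  · refine Ideal.span_le.2 ?_
    rintro _ ⟨f, hf, h0, rfl⟩
    have : m.leadTerm f = C (f.coeff (m.degree f)) * monomial (m.degree f) 1 := by
      rw [C_mul_monomial, mul_one]; rfl
    rw [this]
    exact Ideal.mul_mem_left _ _ (Ideal.subset_span ⟨_, ⟨f, hf, h0, rfl⟩, rfl⟩)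
  · refine Ideal.span_le.2 ?_
    rintro _ ⟨_, ⟨f, hf, h0, rfl⟩, rfl⟩
    have hc := m.coeff_degree_ne_zero_iff.2 h0
    have : monomial (m.degree f) (1 : K) = C (f.coeff (m.degree f))⁻¹ * m.leadTerm f := by
      change _ = C (f.coeff (m.degree f))⁻¹ * monomial (m.degree f) (f.coeff (m.degree f))
      rw [C_mul_monomial, inv_mul_cancel₀ hc]
    simp only [this]
    exact Ideal.mul_mem_left _ _ (Ideal.subset_span ⟨f, hf, h0, rfl⟩)

theorem aux_mem {σ K : Type*} [Field K] (m : MonomialOrder σ)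
    (I : Ideal (MvPolynomial σ K)) (d : σ →₀ ℕ) :
    monomial d (1 : K) ∈ m.initialIdeal I ↔ d ∈ auxExps m I := by
  classical
  rw [aux_initialIdeal]
  constructor
  · rw [mem_ideal_span_monomial_image]
    intro h
    obtain ⟨_, ⟨f, hf, h0, rfl⟩, hle⟩ := h d (by simp)
    have h1 : monomial (d - m.degree f) (1 : K) ≠ 0 := by simp
    refine ⟨monomial (d - m.degree f) 1 * f, Ideal.mul_mem_left _ _ hf, mul_ne_zero h1 h0, ?_⟩
    rw [m.degree_mul h1 h0, m.degree_monomial, if_neg one_ne_zero]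
    exact tsub_add_cancel_of_le hle
  · intro h
    exact Ideal.subset_span ⟨d, h, rfl⟩

theorem aux_prod_X {σ K : Type*} [Field K] (s : Finset σ) :
    (∏ i ∈ s, X i : MvPolynomial σ K) = monomial (∑ i ∈ s, Finsupp.single i 1) 1 := by
  rw [monomial_sum_one]; rfl

theorem aux_sqfree {σ K : Type*} [Field K] {J : Ideal (MvPolynomial σ K)}
    (hJ : IsSqfreeMonomialIdeal J) {d : σ →₀ ℕ} (h : monomial (d + d) (1 : K) ∈ J) :
    monomial d (1 : K) ∈ J := by
  classical
  obtain ⟨G, hG, rfl⟩ := hJ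
  have hG' : G = (fun s => monomial s (1 : K)) '' {e | monomial e (1 : K) ∈ G ∧ ∀ i, e i ≤ 1} := by
    ext g
    constructor
    · intro hg
      obtain ⟨s, rfl⟩ := hG g hg
      refine ⟨∑ i ∈ s, Finsupp.single i 1, ⟨?_, ?_⟩, (aux_prod_X s).symm⟩
      · rwa [← aux_prod_X]
      · intro i
        rw [Finsupp.finsetSum_apply]
        simp only [Finsupp.single_apply, Finset.sum_ite_eq']
        split_ifs <;> simp
    · rintro ⟨e, ⟨he, _⟩, rfl⟩
      exact he
  rw [hG', mem_ideal_span_monomial_image] at h ⊢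
  obtain ⟨e, he, hle⟩ := h (d + d) (by simp)
  intro x hx
  have hx' : d = x := by simpa using support_monomial_subset hx |> Finset.mem_singleton.1 |>.symm
  subst hx'
  refine ⟨e, he, fun i => ?_⟩
  have h1 := he.2 i
  have h2 := hle i
  rw [Finsupp.add_apply] at h2
  omega

theorem aux_le {σ K : Type*} [Field K] (m : MonomialOrder σ)
    {I J : Ideal (MvPolynomial σ K)} (hIJ : I ≤ J) (hD : auxExps m J ⊆ auxExps m I) :
    J ≤ I := by
  suffices H : ∀ a : m.syn, ∀ f ∈ J, m.toSyn (m.degree f) = a → f ∈ I from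
    fun f hf => H _ f hf rfl
  intro a
  induction a using WellFoundedLT.induction with
  | ind a ih =>
    rintro f hf rfl
    by_cases h0 : f = 0
    · rw [h0]; exact I.zero_mem
    obtain ⟨g, hg, hg0, hdeg⟩ := hD ⟨f, hf, h0, rfl⟩
    have hc := m.coeff_degree_ne_zero_iff.2 hg0
    rw [hdeg] at hc
    set c : K := f.coeff (m.degree f) / g.coeff (m.degree f) with hcdef
    have hcg : C c * g ∈ I := Ideal.mul_mem_left _ _ hg
    have key : f - C c * g ∈ I := by
      by_cases hr : f - C c * g = 0
      · rw [hr]; exact I.zero_mem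
      refine ih _ ?_ _ (J.sub_mem hf (hIJ hcg)) rfl
      have hcoef : (f - C c * g).coeff (m.degree f) = 0 := by
        rw [coeff_sub, coeff_C_mul, hcdef, div_mul_cancel₀ _ hc, sub_self]
      refine lt_of_le_of_ne ?_ ?_
      · refine m.degree_sub_le.trans (sup_le le_rfl ?_)
        rw [← smul_eq_C_mul, ← hdeg]
        exact m.degree_smul_le
      · intro he
        have he' := m.toSyn.injective he
        apply m.coeff_degree_ne_zero_iff.2 hr
        rw [he']; exact hcoef
    have := I.add_mem key hcg
    rwa [sub_add_cancel] at this

theorem aux_inf {σ K : Type*} [Field K] (m : MonomialOrder σ)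
    {I J : Ideal (MvPolynomial σ K)} (hs : IsSqfreeMonomialIdeal (m.initialIdeal (I ⊓ J)))
    (h : auxExps m I ⊆ auxExps m J) : I ≤ J := by
  refine le_trans (aux_le m (inf_le_left : I ⊓ J ≤ I) ?_) inf_le_right
  intro d hd
  obtain ⟨f, hf, hf0, hfd⟩ := hd
  obtain ⟨g, hg, hg0, hgd⟩ := h ⟨f, hf, hf0, hfd⟩
  rw [← aux_mem]
  apply aux_sqfree hs
  rw [aux_mem]
  refine ⟨f * g, ⟨Ideal.mul_mem_right _ _ hf, Ideal.mul_mem_left _ _ hg⟩, mul_ne_zero hf0 hg0, ?_⟩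
  rw [m.degree_mul hf0 hg0, hfd, hgd]

theorem aux_finite (n : ℕ) (K : Type*) [Field K] :
    {J : Ideal (MvPolynomial (Fin n) K) | IsSqfreeMonomialIdeal J}.Finite := by
  have h : (Set.range fun s : Finset (Fin n) =>
      (∏ i ∈ s, X i : MvPolynomial (Fin n) K)).Finite := Set.finite_range _
  refine (h.finite_subsets.image Ideal.span).subset ?_
  rintro J ⟨G, hG, rfl⟩
  refine ⟨G, fun g hg => ?_, rfl⟩
  obtain ⟨s, hs⟩ := hG g hg
  exact ⟨s, hs.symm⟩

/-- **Remark (part 2).** If `C` is a family of ideals closed under pairwise intersections whose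
members all have squarefree initial ideal, then `I ↦ lt(I)` is injective on `C`, and `C`
is finite. -/
theorem initialIdeal_injOn_and_finite_of_sqfree_family {n : ℕ} {K : Type*} [Field K]
    (m : MonomialOrder (Fin n)) (C : Set (Ideal (MvPolynomial (Fin n) K)))
    (hC : ∀ I ∈ C, ∀ J ∈ C, I ⊓ J ∈ C)
    (hsq : ∀ I ∈ C, IsSqfreeMonomialIdeal (m.initialIdeal I)) :
    Set.InjOn m.initialIdeal C ∧ C.Finite := by
  have hinj : Set.InjOn m.initialIdeal C := by
    intro I hI J hJ h
    have hE : auxExps m I = auxExps m J := by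
      ext d
      rw [← aux_mem, ← aux_mem, h]
    exact le_antisymm (aux_inf m (hsq _ (hC I hI J hJ)) hE.subset)
      (aux_inf m (hsq _ (hC J hJ I hI)) hE.symm.subset)
  refine ⟨hinj, Set.Finite.of_finite_image ((aux_finite n K).subset ?_) hinj⟩
  rintro _ ⟨I, hI, rfl⟩
  exact hsq I hI
end

section
/- Let S = K[x₁,…,xₙ] be a polynomial ring over a field K with a fixed term order ≺, and let I, J ⊆ S be homogeneous ideals. Then lt(I ∩ J) = lt(I) ∩ lt(J) if and only if lt(I + J) = lt(I) + lt(J). -/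
open MvPolynomial

/-- An ideal of `K[x₁,…,xₙ]` is homogeneous if it contains all the homogeneous components of
each of its elements. -/
def IsHomogeneousIdeal {n : ℕ} {K : Type*} [Field K]
    (I : Ideal (MvPolynomial (Fin n) K)) : Prop :=
  ∀ g ∈ I, ∀ k : ℕ, MvPolynomial.homogeneousComponent k g ∈ I

namespace InitAux

variable {n : ℕ} {K : Type*} [Field K]

/-- `a` is the leading exponent of `f`. -/
def Lead (m : MonomialOrder (Fin n)) (f : MvPolynomial (Fin n) K) (a : Fin n →₀ ℕ) : Prop :=
  coeff a f ≠ 0 ∧ ∀ b, coeff b f ≠ 0 → m.toSyn b ≤ m.toSyn a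

/-- The set of leading exponents of an ideal. -/
def L (m : MonomialOrder (Fin n)) (I : Ideal (MvPolynomial (Fin n) K)) : Set (Fin n →₀ ℕ) :=
  {a | ∃ f ∈ I, Lead m f a}

lemma lead_degreeOf (m : MonomialOrder (Fin n)) {f : MvPolynomial (Fin n) K} (hf : f ≠ 0) :
    Lead m f (m.degreeOf f) := by
  refine ⟨?_, ?_⟩
  · exact (m.coeff_degree_ne_zero_iff).2 hf
  · intro b hb
    exact m.le_degree (mem_support_iff.2 hb)

lemma Lead.ne_zero {m : MonomialOrder (Fin n)} {f : MvPolynomial (Fin n) K} {a} (h : Lead m f a) :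
    f ≠ 0 := by
  rintro rfl
  exact h.1 (by simp)

lemma Lead.eq {m : MonomialOrder (Fin n)} {f : MvPolynomial (Fin n) K} {a b} (h : Lead m f a)
    (h' : Lead m f b) : a = b :=
  m.toSyn.injective (le_antisymm (h'.2 _ h.1) (h.2 _ h'.1))

lemma Lead.zero {m : MonomialOrder (Fin n)} {f : MvPolynomial (Fin n) K} {a b} (h : Lead m f a)
    (h' : m.toSyn a < m.toSyn b) : coeff b f = 0 := by
  by_contra hb
  exact absurd (h.2 _ hb) (not_le.2 h')

lemma L_up (m : MonomialOrder (Fin n)) (I : Ideal (MvPolynomial (Fin n) K)) {a b : Fin n →₀ ℕ}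
    (ha : a ∈ L m I) (hab : a ≤ b) : b ∈ L m I := by
  obtain ⟨f, hf, h1, h2⟩ := ha
  refine ⟨monomial (b - a) 1 * f, I.mul_mem_left _ hf, ?_, ?_⟩
  · rw [coeff_monomial_mul', if_pos tsub_le_self, tsub_tsub_cancel_of_le hab]
    simpa using h1
  · intro c hc
    rw [coeff_monomial_mul'] at hc
    split_ifs at hc with h
    · have := h2 (c - (b - a)) (by simpa using hc)
      have e1 : c = (c - (b - a)) + (b - a) := (tsub_add_cancel_of_le h).symm
      have e2 : b = a + (b - a) := (add_tsub_cancel_of_le hab).symm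
      rw [e1]
      conv_rhs => rw [e2]
      rw [map_add, map_add]
      gcongr
    · exact absurd rfl hc

/-- The monomial ideal on a set of exponents. -/
noncomputable def M (K : Type*) [Field K] (S : Set (Fin n →₀ ℕ)) : Ideal (MvPolynomial (Fin n) K) :=
  Ideal.span ((fun s => monomial s (1 : K)) '' S)

lemma mem_M {S : Set (Fin n →₀ ℕ)} (hS : ∀ a b, a ∈ S → a ≤ b → b ∈ S)
    (f : MvPolynomial (Fin n) K) : f ∈ M K S ↔ ∀ d, coeff d f ≠ 0 → d ∈ S := by
  unfold M
  rw [mem_ideal_span_monomial_image]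
  constructor
  · intro h d hd
    obtain ⟨s, hs, hsd⟩ := h d (mem_support_iff.2 hd)
    exact hS _ _ hs hsd
  · intro h d hd
    exact ⟨d, h d (mem_support_iff.1 hd), le_rfl⟩

lemma M_eq_iff {S T : Set (Fin n →₀ ℕ)} (hS : ∀ a b, a ∈ S → a ≤ b → b ∈ S)
    (hT : ∀ a b, a ∈ T → a ≤ b → b ∈ T) : M K S = M K T ↔ S = T := by
  constructor
  · intro h
    have key : ∀ {S : Set (Fin n →₀ ℕ)} (_ : ∀ a b, a ∈ S → a ≤ b → b ∈ S) (d),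
        monomial d (1 : K) ∈ M K S ↔ d ∈ S := by
      intro S hS d
      rw [mem_M hS]
      classical
      simp [coeff_monomial]
    ext d
    rw [← key hS, ← key hT, h]
  · rintro rfl
    rfl

lemma M_inf {S T : Set (Fin n →₀ ℕ)} (hS : ∀ a b, a ∈ S → a ≤ b → b ∈ S)
    (hT : ∀ a b, a ∈ T → a ≤ b → b ∈ T) : M K S ⊓ M K T = M K (S ∩ T) := by
  ext f
  rw [Ideal.mem_inf, mem_M hS, mem_M hT,
    mem_M (S := S ∩ T) (fun a b h hab => ⟨hS a b h.1 hab, hT a b h.2 hab⟩)]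
  exact ⟨fun h d hd => ⟨h.1 d hd, h.2 d hd⟩, fun h => ⟨fun d hd => (h d hd).1, fun d hd => (h d hd).2⟩⟩

lemma M_add {S T : Set (Fin n →₀ ℕ)} : M K S + M K T = M K (S ∪ T) := by
  unfold M
  rw [Set.image_union, Ideal.span_union]
  rfl

lemma initialIdeal_eq (m : MonomialOrder (Fin n)) (I : Ideal (MvPolynomial (Fin n) K)) :
    m.initialIdeal I = M K (L m I) := by
  apply le_antisymm
  · refine Ideal.span_le.2 ?_
    rintro _ ⟨f, hf, h0, rfl⟩
    rw [SetLike.mem_coe, mem_M (fun a b => L_up m I)]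
    intro d hd
    unfold MonomialOrder.leadTerm at hd
    classical
    rw [coeff_monomial] at hd
    split_ifs at hd with h
    · exact h ▸ ⟨f, hf, lead_degreeOf m h0⟩
    · exact absurd rfl hd
  · refine Ideal.span_le.2 ?_
    rintro _ ⟨d, ⟨f, hf, hd⟩, rfl⟩
    have e := (lead_degreeOf m hd.ne_zero).eq hd
    have h1 : m.leadTerm f ∈ m.initialIdeal I := Ideal.subset_span ⟨f, hf, hd.ne_zero, rfl⟩
    have h2 := Ideal.mul_mem_left _ (C (coeff d f)⁻¹) h1
    unfold MonomialOrder.leadTerm at h2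
    rw [e, C_mul_monomial, inv_mul_cancel₀ hd.1] at h2
    exact h2

/-- Cancelling the leading term. -/
lemma cancel {m : MonomialOrder (Fin n)} {f p : MvPolynomial (Fin n) K} {a : Fin n →₀ ℕ}
    (hf : Lead m f a) (hp : Lead m p a) {b} (hb : Lead m (f - C (coeff a f / coeff a p) * p) b) :
    m.toSyn b < m.toSyn a := by
  by_contra h
  apply hb.1
  rw [coeff_sub, coeff_C_mul]
  rcases (not_lt.1 h).lt_or_eq with h | h
  · simp [hf.zero h, hp.zero h]
  · obtain rfl := m.toSyn.injective h
    rw [div_mul_cancel₀ _ hp.1, sub_self]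

lemma add_of_inf (m : MonomialOrder (Fin n)) (I J : Ideal (MvPolynomial (Fin n) K))
    (h : L m I ∩ L m J ⊆ L m (I ⊓ J)) (s : m.syn) :
    ∀ a, m.toSyn a = s → ∀ f ∈ I, ∀ g ∈ J, Lead m f a → ∀ d, Lead m (f + g) d →
      d ∈ L m I ∪ L m J := by
  induction s using WellFoundedLT.induction with
  | ind s ih =>
  rintro a rfl f hf g hg hfa d hd
  by_cases hg0 : g = 0
  · subst hg0
    exact Or.inl ⟨f, hf, by simpa using hd⟩
  have hgb := lead_degreeOf m hg0
  generalize m.degreeOf g = b at hgb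
  by_cases hda : d = a
  · exact Or.inl ⟨f, hf, hda ▸ hfa⟩
  by_cases hdb : d = b
  · exact Or.inr ⟨g, hg, hdb ▸ hgb⟩
  have hab : a = b := by
    by_contra hab
    rcases lt_or_gt_of_ne (fun e => hab (m.toSyn.injective e)) with hlt | hlt
    · apply hdb
      refine hd.eq ⟨?_, ?_⟩
      · rw [coeff_add, hfa.zero hlt, zero_add]
        exact hgb.1
      · intro c hc
        by_contra hcb
        rw [not_le] at hcb
        exact hc (by rw [coeff_add, hgb.zero hcb, hfa.zero (hlt.trans hcb), zero_add])
    · apply hda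
      refine hd.eq ⟨?_, ?_⟩
      · rw [coeff_add, hgb.zero hlt, add_zero]
        exact hfa.1
      · intro c hc
        by_contra hcb
        rw [not_le] at hcb
        exact hc (by rw [coeff_add, hfa.zero hcb, hgb.zero (hlt.trans hcb), zero_add])
  subst hab
  obtain ⟨p, hp, hpa⟩ := h ⟨⟨f, hf, hfa⟩, ⟨g, hg, hgb⟩⟩
  set q := C (coeff a f / coeff a p) * p with hq
  have hqI : q ∈ I := I.mul_mem_left _ hp.1
  have hqJ : q ∈ J := J.mul_mem_left _ hp.2
  have e : f + g = (f - q) + (g + q) := by ring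
  by_cases h0 : f - q = 0
  · rw [e, h0, zero_add] at hd
    exact Or.inr ⟨_, J.add_mem hg hqJ, hd⟩
  · have hl := lead_degreeOf m h0
    exact ih _ (cancel hfa hpa hl) _ rfl _ (I.sub_mem hf hqI) _ (J.add_mem hg hqJ) hl d (e ▸ hd)

/-- Elements of the sum decompose without cancellation. -/
lemma decomp (m : MonomialOrder (Fin n)) (I J : Ideal (MvPolynomial (Fin n) K))
    (h : L m (I + J) ⊆ L m I ∪ L m J) (s : m.syn) :
    ∀ a, m.toSyn a = s → ∀ f ∈ I + J, Lead m f a → ∃ u ∈ I, ∃ v ∈ J, f = u + v ∧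
      ∀ b, m.toSyn a < m.toSyn b → coeff b u = 0 ∧ coeff b v = 0 := by
  induction s using WellFoundedLT.induction with
  | ind s ih =>
  rintro a rfl f hf hfa
  have aux : ∀ p ∈ I + J, Lead m p a → ∃ u ∈ I, ∃ v ∈ J,
      f - C (coeff a f / coeff a p) * p = u + v ∧
      ∀ b, m.toSyn a < m.toSyn b → coeff b u = 0 ∧ coeff b v = 0 := by
    intro p hp hpa
    by_cases h0 : f - C (coeff a f / coeff a p) * p = 0
    · exact ⟨0, I.zero_mem, 0, J.zero_mem, by rw [h0, add_zero], by simp⟩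
    · have hl := lead_degreeOf m h0
      have hlt := cancel hfa hpa hl
      obtain ⟨u, hu, v, hv, e, H⟩ := ih _ hlt _ rfl _
        ((I + J).sub_mem hf ((I + J).mul_mem_left _ hp)) hl
      exact ⟨u, hu, v, hv, e, fun b hb => H b (hlt.trans hb)⟩
  rcases h ⟨f, hf, hfa⟩ with ⟨p, hp, hpa⟩ | ⟨p, hp, hpa⟩
  · obtain ⟨u, hu, v, hv, e, H⟩ := aux p (Ideal.mem_sup_left hp) hpa
    refine ⟨u + C (coeff a f / coeff a p) * p, I.add_mem hu (I.mul_mem_left _ hp), v, hv,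
      by linear_combination e, fun b hb => ⟨?_, (H b hb).2⟩⟩
    rw [coeff_add, coeff_C_mul, (H b hb).1, hpa.zero hb, mul_zero, add_zero]
  · obtain ⟨u, hu, v, hv, e, H⟩ := aux p (Ideal.mem_sup_right hp) hpa
    refine ⟨u, hu, v + C (coeff a f / coeff a p) * p, J.add_mem hv (J.mul_mem_left _ hp),
      by linear_combination e, fun b hb => ⟨(H b hb).1, ?_⟩⟩
    rw [coeff_add, coeff_C_mul, (H b hb).2, hpa.zero hb, mul_zero, add_zero]

lemma inf_of_add (m : MonomialOrder (Fin n)) (I J : Ideal (MvPolynomial (Fin n) K))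
    (h : L m (I + J) ⊆ L m I ∪ L m J) : L m I ∩ L m J ⊆ L m (I ⊓ J) := by
  rintro a ⟨⟨f, hf, hfa⟩, ⟨g, hg, hga⟩⟩
  set q := C (coeff a f / coeff a g) * g with hq
  have hqJ : q ∈ J := J.mul_mem_left _ hg
  by_cases h0 : f - q = 0
  · exact ⟨f, ⟨hf, by rw [sub_eq_zero.1 h0]; exact hqJ⟩, hfa⟩
  have hl := lead_degreeOf m h0
  have hlt := cancel hfa hga hl
  obtain ⟨u, hu, v, hv, e, H⟩ := decomp m I J h _ _ rfl _
    ((I + J).sub_mem (Ideal.mem_sup_left hf) (Ideal.mem_sup_right hqJ)) hl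
  refine ⟨f - u, ⟨I.sub_mem hf hu, ?_⟩, ?_, ?_⟩
  · have : f - u = q + v := by linear_combination e
    rw [this]
    exact J.add_mem hqJ hv
  · rw [coeff_sub, (H a hlt).1, sub_zero]
    exact hfa.1
  · intro b hb
    by_contra hba
    rw [not_le] at hba
    exact hb (by rw [coeff_sub, (H b (hlt.trans hba)).1, hfa.zero hba, sub_zero])

lemma L_mono (m : MonomialOrder (Fin n)) {I J : Ideal (MvPolynomial (Fin n) K)} (h : I ≤ J) :
    L m I ⊆ L m J := fun _ ⟨f, hf, hl⟩ => ⟨f, h hf, hl⟩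

end InitAux

/-- For homogeneous ideals `I, J`, one has `lt(I ∩ J) = lt(I) ∩ lt(J)` if and only if
`lt(I + J) = lt(I) + lt(J)`. -/
theorem initialIdeal_inf_iff_initialIdeal_add {n : ℕ} {K : Type*} [Field K]
    (m : MonomialOrder (Fin n)) (I J : Ideal (MvPolynomial (Fin n) K))
    (hI : IsHomogeneousIdeal I) (hJ : IsHomogeneousIdeal J) :
    m.initialIdeal (I ⊓ J) = m.initialIdeal I ⊓ m.initialIdeal J ↔
      m.initialIdeal (I + J) = m.initialIdeal I + m.initialIdeal J := by
  have hadd : InitAux.L m I ∪ InitAux.L m J ⊆ InitAux.L m (I + J) :=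
    Set.union_subset (InitAux.L_mono m le_sup_left) (InitAux.L_mono m le_sup_right)
  have hinf : InitAux.L m (I ⊓ J) ⊆ InitAux.L m I ∩ InitAux.L m J :=
    Set.subset_inter (InitAux.L_mono m inf_le_left) (InitAux.L_mono m inf_le_right)
  rw [InitAux.initialIdeal_eq, InitAux.initialIdeal_eq, InitAux.initialIdeal_eq, InitAux.initialIdeal_eq,
    InitAux.M_inf (fun _ _ => InitAux.L_up m I) (fun _ _ => InitAux.L_up m J), InitAux.M_add,
    InitAux.M_eq_iff (T := InitAux.L m I ∩ InitAux.L m J) (fun _ _ => InitAux.L_up m _)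
      (fun _ _ h hab => ⟨InitAux.L_up m I h.1 hab, InitAux.L_up m J h.2 hab⟩),
    InitAux.M_eq_iff (T := InitAux.L m I ∪ InitAux.L m J) (fun _ _ => InitAux.L_up m _)
      (fun _ _ h hab => h.imp (fun h => InitAux.L_up m I h hab) (fun h => InitAux.L_up m J h hab))]
  constructor
  · intro h
    refine Set.Subset.antisymm ?_ hadd
    rintro d ⟨k, hk, hd⟩
    obtain ⟨f, hf, g, hg, rfl⟩ := Submodule.mem_sup.1 hk
    by_cases h0 : f = 0
    · subst h0
      exact Or.inr ⟨g, hg, by simpa using hd⟩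
    · exact InitAux.add_of_inf m I J h.ge _ _ rfl f hf g hg (InitAux.lead_degreeOf m h0) d hd
  · intro h
    exact Set.Subset.antisymm hinf (InitAux.inf_of_add m I J h.le)
end

section
/- Let K be a field of characteristic p > 0 with algebraic closure K̄, let S = K[x₁,…,xₙ] and S̄ = K̄[x₁,…,xₙ], and let f ∈ S have squarefree leading term with respect to a fixed term order ≺. If I ∈ C_f, then the extended ideal I·S̄ belongs to C_{f̄}, where f̄ is the image of f in S̄. -/
open MvPolynomial

/-- Membership in an extended ideal along a free extension is tested on coordinates. -/
theorem knutson_mem_map_iff_of_basis {A B ι : Type*} [CommRing A] [CommRing B] [Algebra A B]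
    (b : Module.Basis ι A B) (I : Ideal A) (g : B) :
    g ∈ I.map (algebraMap A B) ↔ ∀ i, b.repr g i ∈ I := by
  constructor
  · intro hg i
    induction hg using Submodule.span_induction generalizing i with
    | mem x hx =>
      obtain ⟨a, ha, rfl⟩ := hx
      rw [Algebra.algebraMap_eq_smul_one, map_smul]
      exact I.mul_mem_right _ ha
    | zero => simp
    | add x y _ _ hx hy => simpa using I.add_mem (hx i) (hy i)
    | smul c x _ hx =>
      rw [smul_eq_mul, ← b.linearCombination_repr x, Finsupp.linearCombination_apply,
        Finsupp.sum, Finset.mul_sum, map_sum, Finsupp.finsetSum_apply]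
      refine I.sum_mem fun j _ => ?_
      rw [mul_smul_comm, map_smul]
      exact I.mul_mem_right _ (hx j)
  · intro h
    rw [← b.linearCombination_repr g, Finsupp.linearCombination_apply]
    refine Ideal.sum_mem _ fun j _ => ?_
    beta_reduce
    rw [Algebra.smul_def]
    exact Ideal.mul_mem_right _ _ (Ideal.mem_map_of_mem _ (h j))

theorem knutson_map_inf_of_basis {A B ι : Type*} [CommRing A] [CommRing B] [Algebra A B]
    (b : Module.Basis ι A B) (I J : Ideal A) :
    (I ⊓ J).map (algebraMap A B) = I.map (algebraMap A B) ⊓ J.map (algebraMap A B) := by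
  ext g
  simp only [Ideal.mem_inf, knutson_mem_map_iff_of_basis b, forall_and]

theorem knutson_map_colon_of_basis {A B ι : Type*} [CommRing A] [CommRing B] [Algebra A B]
    (b : Module.Basis ι A B) (I J : Ideal A) :
    (I.colon (J : Set A)).map (algebraMap A B) =
      (I.map (algebraMap A B)).colon (J.map (algebraMap A B) : Set B) := by
  ext g
  have hJ : (I.map (algebraMap A B)).colon (J.map (algebraMap A B) : Set B) =
      (I.map (algebraMap A B)).colon (Set.image (algebraMap A B) (J : Set A)) := Ideal.colon_span
  rw [hJ]
  simp only [knutson_mem_map_iff_of_basis b, Submodule.mem_colon, Set.forall_mem_image,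
    smul_eq_mul, SetLike.mem_coe]
  have key : ∀ (a : A) (i : ι), b.repr (g * algebraMap A B a) i = b.repr g i * a := by
    intro a i
    rw [mul_comm g, ← Algebra.smul_def, map_smul, Finsupp.smul_apply, smul_eq_mul, mul_comm]
  simp only [key]
  exact ⟨fun h a ha i => h i a ha, fun h i a ha => h ha i⟩

attribute [local instance] MvPolynomial.algebraMvPolynomial in
theorem knutson_free_aux (σ K L : Type*) [Field K] [Field L] [Algebra K L] :
    Module.Free (MvPolynomial σ K) (MvPolynomial σ L) :=
  IsBaseChange.free (Algebra.IsPushout.out (R := K) (S := MvPolynomial σ K) (R' := L)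
    (S' := MvPolynomial σ L))

/-- **Claim in the proof of Proposition 2.1.** Let `K` be a field of characteristic `p > 0`
with algebraic closure `K̄`, and let `f ∈ S = K[x₁,…,xₙ]` have squarefree leading term.
If `I ∈ C_f`, then `I·S̄ ∈ C_f̄`, where `f̄` is the image of `f` in `S̄ = K̄[x₁,…,xₙ]`. -/
theorem knutson_map_algebraicClosure {n : ℕ} {K : Type*} [Field K]
    (p : ℕ) [CharP K p] (hp : 0 < p)
    (m : MonomialOrder (Fin n)) (f : MvPolynomial (Fin n) K)
    (hf : m.HasSqfreeLeadTerm f)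
    (I : Ideal (MvPolynomial (Fin n) K)) (hI : KnutsonFamily f I) :
    KnutsonFamily
      (MvPolynomial.map (algebraMap K (AlgebraicClosure K)) f)
      (Ideal.map (MvPolynomial.map (algebraMap K (AlgebraicClosure K))) I) := by
  classical
  letI : Algebra (MvPolynomial (Fin n) K) (MvPolynomial (Fin n) (AlgebraicClosure K)) :=
    MvPolynomial.algebraMvPolynomial
  obtain ⟨⟨ι, b⟩⟩ := knutson_free_aux (Fin n) K (AlgebraicClosure K)
  rw [← MvPolynomial.algebraMap_def]
  induction hI with
  | base =>
    rw [Ideal.map_span, Set.image_singleton]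
    exact KnutsonFamily.base
  | colon I J _ ih =>
    rw [knutson_map_colon_of_basis b]
    exact KnutsonFamily.colon _ _ ih
  | add I J _ _ ihI ihJ =>
    rw [Submodule.add_eq_sup, Ideal.map_sup, ← Submodule.add_eq_sup]
    exact KnutsonFamily.add _ _ ihI ihJ
  | inter I J _ _ ihI ihJ =>
    rw [knutson_map_inf_of_basis b]
    exact KnutsonFamily.inter _ _ ihI ihJ
end
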